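/- For every integer m ≥ 2, the constant ν_m is transcendental over ℚ, and there are infinitely many pairs of integers (p,q) with q > 0 such that 0 < |ν_m − p/q| < 1/q^{m+1}; in particular, the irrationality measure of ν_m is at least m+1. -/

import Mathlib

open List Filter

open scoped Classical

noncomputable section

/-- The curling number of a finite string: the largest `k` such that
`S = X ++ Y^k` with `Y` nonempty; by convention `curl [] = 1`. -/
def curl (S : List ℕ) : ℕ :=
  max 1 (sSup {k | ∃ X Y : List ℕ, Y ≠ [] ∧ S = X ++ (List.replicate k Y).flatten})

/-- The prefix of length `n` of the level-`m` Gijswijt sequence `A^(m)`. -/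
def gPrefix (m : ℕ) : ℕ → List ℕ
  | 0 => []
  | n + 1 => gPrefix m n ++ [max m (curl (gPrefix m n))]

/-- `gij m p` is the `p`-th term (1-indexed) of the level-`m` Gijswijt sequence `A^(m)`. -/
def gij (m p : ℕ) : ℕ := max m (curl (gPrefix m (p - 1)))

/-- Standing hypothesis: for every `m ≥ 1`, the sets
`{k ≥ 0 : C(A^(m)[1,k]) ≤ m}` and `{k ≥ 0 : C(A^(m+1)[1,k]) ≤ m}` are infinite. -/
def StandingHyp : Prop :=
  ∀ m : ℕ, 1 ≤ m →
    {k : ℕ | curl (gPrefix m k) ≤ m}.Infinite ∧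
    {k : ℕ | curl (gPrefix (m + 1) k) ≤ m}.Infinite

/-- Length of `π^(m)(1,x)`: the `x`-th smallest (0-indexed) element of
`{k : C(A^(m)[1,k]) ≤ m}`. -/
def piLen (m x : ℕ) : ℕ := Nat.nth (fun k => curl (gPrefix m k) ≤ m) x

/-- `π^(m)(1,x)`: the prefix of `A^(m)` with exactly `x` occurrences of `m`
and curling number at most `m`. -/
def piStr (m x : ℕ) : List ℕ := gPrefix m (piLen m x)

/-- `β^(m)(t)`, the length of `B_t^(m)`. -/
def beta (m t : ℕ) : ℕ := piLen m ((m + 1) ^ (t - 1))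

/-- `B_t^(m) := π^(m)(1,(m+1)^(t-1))`. -/
def Bstr (m t : ℕ) : List ℕ := piStr m ((m + 1) ^ (t - 1))

/-- `τ^(m)(t)`, the length of `T_t^(m)`. -/
def tau (m t : ℕ) : ℕ := Nat.nth (fun k => curl (gPrefix (m + 1) k) ≤ m) (t - 1)

/-- `T_t^(m)`: the `t`-th shortest prefix of `A^(m+1)` with curling number at most `m`. -/
def Tstr (m t : ℕ) : List ℕ := gPrefix (m + 1) (tau m t)

/-- `φ^(m)(n)`: the least `p ≥ 1` with `A^(m)(p) = n`. -/
def phi (m n : ℕ) : ℕ := sInf {p : ℕ | 1 ≤ p ∧ gij m p = n}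

/-- `t^(m)(n) = 1 + log_{m+1} #\{i ≤ φ^(m)(n) : A^(m)(i) = m\}`. -/
def tfun (m n : ℕ) : ℕ := 1 + Nat.log (m + 1) ((gPrefix m (phi m n)).count m)

/-- `χ^(b)(a)`: read the base-`b` digits of `a` as base-`(b+1)` digits. -/
def chi (b a : ℕ) : ℕ := Nat.ofDigits (b + 1) (Nat.digits b a)

/-- `ι_m(t)`: read the base-`(m+2)` digits of the number of occurrences of `m+1`
in `T_t^(m)` as base-`(m+1)` digits. -/
def iota (m t : ℕ) : ℕ :=
  Nat.ofDigits (m + 1) (Nat.digits (m + 2) ((Tstr m t).count (m + 1)))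

/-- `ι_m⁻¹(p)`: the largest `x ≥ 1` with `ι_m(x) ≤ p`. -/
def iotaInv (m p : ℕ) : ℕ := sSup {x : ℕ | 1 ≤ x ∧ iota m x ≤ p}

/-- `ord_b(n)`: the `b`-adic valuation of `n`. -/
def ordb (b n : ℕ) : ℕ := sSup {z : ℕ | b ^ z ∣ n}

/-- The largest base-`b` digit of `n`. -/
def maxdigit (b n : ℕ) : ℕ := (Nat.digits b n).foldr max 0

/-- Auxiliary function for the level-`m` expansion: `lexpAux m a k = a_{m+1+k}`. -/
def lexpAux (m a : ℕ) : ℕ → ℕ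
  | 0 => a
  | k + 1 => iota (m + 1 + k) (ordb (m + 1 + k) (lexpAux m a k) + 1)

/-- `lexp m a l = a_l`, the `l`-th term of the level-`m` expansion of `a`. -/
def lexp (m a l : ℕ) : ℕ := lexpAux m a (l - (m + 1))

/-- The last element `n` of `π^(m+1)(1, χ^(m+1)(a))`; the level-`m` expansion
of `a` is `a_{m+1}, …, a_n`. -/
def levelEnd (m a : ℕ) : ℕ := (piStr (m + 1) (chi (m + 1) a)).getLastD 0

/-- `V_m := {v ≥ 0 : C(T_{v+1}^(m+1)) ≤ m}`. -/
def Vset (m : ℕ) : Set ℕ := {v | curl (Tstr (m + 1) (v + 1)) ≤ m}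

/-- `Q := {α ≥ 0 : C(T_{α+1}^(2)) = 1}`. -/
def Qset : Set ℕ := {a | curl (Tstr 2 (a + 1)) = 1}

/-- `R := {(a,b) : a ∈ Q, a < b, no suffix S of T_{a+1}^(2) with T_{a+1}^(2)·S = T_{b+1}^(2)}`. -/
def Rset : Set (ℕ × ℕ) :=
  {p | p.1 ∈ Qset ∧ p.1 < p.2 ∧
    ¬∃ S : List ℕ, S <:+ Tstr 2 (p.1 + 1) ∧ Tstr 2 (p.1 + 1) ++ S = Tstr 2 (p.2 + 1)}

/-- The digit of `x` in base `b` at (1-indexed) position `i`, i.e. the coefficient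
of `b^(i-1)`. -/
def digitAt (b x i : ℕ) : ℕ := (Nat.digits b x).getD (i - 1) 0

/-- `u` is the (1-indexed) position of the second nonzero base-`b` digit of `x`
(the first nonzero digit being at position `ord_b(x)+1`). -/
def IsSecondNonzero (b x u : ℕ) : Prop :=
  ordb b x + 1 < u ∧ digitAt b x u ≠ 0 ∧
    ∀ i, ordb b x + 1 < i → i < u → digitAt b x i = 0

/-- `𝒮_b`: pairs `(a,a')` with `1 ≤ a < a'` such that for some position `y` the
base-`b` digits of `a` and `a'` agree away from `y` and twice the `y`-th digit of `a`
is at least the `y`-th digit of `a'`. -/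
def Sset (b : ℕ) : Set (ℕ × ℕ) :=
  {p | 1 ≤ p.1 ∧ p.1 < p.2 ∧
    ∃ y : ℕ, (∀ i, i ≠ y → (Nat.digits b p.1).getD i 0 = (Nat.digits b p.2).getD i 0) ∧
      (Nat.digits b p.2).getD y 0 ≤ 2 * (Nat.digits b p.1).getD y 0}

/-- The glue string `S_t^(m)`, so that `T_{t+1}^(m) = T_t^(m) ++ glue m t`. -/
def glue (m t : ℕ) : List ℕ := (gPrefix (m + 1) (tau m (t + 1))).drop (tau m t)

/-- The strings `P_t^(m)`: `P_1^(m) = (m)` and `P_{t+1}^(m) = P_t^(m)·B_t^(m)·S_t^(m)`. -/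
def Pstr (m : ℕ) : ℕ → List ℕ
  | 0 => []
  | 1 => [m]
  | t + 2 => Pstr m (t + 1) ++ Bstr m (t + 1) ++ glue m (t + 1)

end

/-! ### Curling numbers -/

theorem le_length_of_eq_append_flatten_replicate {S X Y : List ℕ} {k : ℕ} (hY : Y ≠ [])
    (h : S = X ++ (List.replicate k Y).flatten) : k ≤ S.length := by
  have h1 : 1 ≤ Y.length := List.length_pos_iff.2 hY
  have h2 : S.length = X.length + k * Y.length := by simp [h]
  nlinarith

theorem le_curl_iff {S : List ℕ} {j : ℕ} (hj : 2 ≤ j) :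
    j ≤ curl S ↔ ∃ X Y : List ℕ, Y ≠ [] ∧ S = X ++ (List.replicate j Y).flatten := by
  have hbdd : BddAbove {k | ∃ X Y : List ℕ, Y ≠ [] ∧ S = X ++ (List.replicate k Y).flatten} :=
    ⟨S.length, by rintro k ⟨X, Y, hY, h⟩; exact le_length_of_eq_append_flatten_replicate hY h⟩
  have hne : {k | ∃ X Y : List ℕ, Y ≠ [] ∧ S = X ++ (List.replicate k Y).flatten}.Nonempty :=
    ⟨0, S, [0], by simp⟩
  constructor
  · intro h
    have h1 : j ≤ sSup {k | ∃ X Y : List ℕ, Y ≠ [] ∧ S = X ++ (List.replicate k Y).flatten} := by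
      rcases le_max_iff.1 h with h | h
      · omega
      · exact h
    obtain ⟨X, Y, hY, hS⟩ := Nat.sSup_mem hne hbdd
    set s := sSup {k | ∃ X Y : List ℕ, Y ≠ [] ∧ S = X ++ (List.replicate k Y).flatten}
    refine ⟨X ++ (List.replicate (s - j) Y).flatten, Y, hY, ?_⟩
    rw [List.append_assoc, ← List.flatten_append, List.replicate_append_replicate,
      Nat.sub_add_cancel h1]
    exact hS
  · intro h
    exact le_max_of_le_right (le_csSup hbdd h)

theorem one_le_curl (S : List ℕ) : 1 ≤ curl S := le_max_left _ _

theorem curl_nil : curl [] = 1 := by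
  refine le_antisymm ?_ (one_le_curl _)
  by_contra! h
  obtain ⟨X, Y, hY, h⟩ := (le_curl_iff (S := []) (j := 2) le_rfl).1 h
  simp [List.replicate_succ, hY] at h

theorem curl_le_of_suffix {S S' : List ℕ} (h : S <:+ S') : curl S ≤ curl S' := by
  by_contra! hlt
  have h1 := one_le_curl S'
  obtain ⟨X, Y, hY, hS⟩ := (le_curl_iff (by omega)).1 (le_refl (curl S))
  obtain ⟨W, hW⟩ := h
  exact absurd ((le_curl_iff (S := S') (by omega)).2
    ⟨W ++ X, Y, hY, by rw [List.append_assoc, ← hS, hW]⟩) (not_le.2 hlt)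

/-! ### Prefixes of the Gijswijt sequences -/

theorem length_gPrefix (m k : ℕ) : (gPrefix m k).length = k := by
  induction k with
  | zero => rfl
  | succ k ih => simp [gPrefix, ih]

theorem gPrefix_prefix_gPrefix (m : ℕ) {k l : ℕ} (h : k ≤ l) : gPrefix m k <+: gPrefix m l := by
  induction l, h using Nat.le_induction with
  | base => exact List.prefix_refl _
  | succ l _ ih => exact ih.trans (List.prefix_append _ _)

theorem le_of_mem_gPrefix {m k a : ℕ} (h : a ∈ gPrefix m k) : m ≤ a := by
  induction k with
  | zero => simp [gPrefix] at h
  | succ k ih =>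
    rcases List.mem_append.1 h with h | h
    · exact ih h
    · rw [List.mem_singleton] at h; rw [h]; exact le_max_left _ _

/-! ### Words cut into runs by a separator letter -/

/-- The word `n r₁ n r₂ ⋯ n r_X`. -/
def runWord (n : ℕ) (r : ℕ → List ℕ) : ℕ → List ℕ
  | 0 => []
  | X + 1 => runWord n r X ++ n :: r (X + 1)

theorem count_runWord {n : ℕ} {r : ℕ → List ℕ} (hr : ∀ i, n ∉ r i) (X : ℕ) :
    (runWord n r X).count n = X := by
  induction X with
  | zero => rfl
  | succ X ih => simp [runWord, ih, List.count_eq_zero_of_not_mem (hr _)]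

theorem runWord_congr {n : ℕ} {r r' : ℕ → List ℕ} {X : ℕ} (h : ∀ i, 0 < i → i ≤ X → r i = r' i) :
    runWord n r X = runWord n r' X := by
  induction X with
  | zero => rfl
  | succ X ih =>
    simp only [runWord]
    rw [ih fun i hi hiX => h i hi (by omega), h (X + 1) (by omega) le_rfl]

theorem append_cons_inj_of_notMem_right {n : ℕ} {a b c d : List ℕ} (hb : n ∉ b) (hd : n ∉ d)
    (h : a ++ n :: b = c ++ n :: d) : a = c ∧ b = d := by
  rcases List.append_eq_append_iff.1 h with ⟨e, rfl, he⟩ | ⟨e, rfl, he⟩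
  · cases e with
    | nil => simpa using he
    | cons x e =>
      rw [List.cons_append, List.cons.injEq] at he
      exact absurd (he.2 ▸ by simp) hb
  · cases e with
    | nil => simpa using he.symm
    | cons x e =>
      rw [List.cons_append, List.cons.injEq] at he
      exact absurd (he.2 ▸ by simp) hd

theorem exists_eq_append_cons_notMem_right {n : ℕ} {Z : List ℕ} (h : n ∈ Z) :
    ∃ Z₁ z, Z = Z₁ ++ n :: z ∧ n ∉ z := by
  obtain ⟨a, b, hab, ha⟩ := List.eq_append_cons_of_mem (List.mem_reverse.2 h)
  refine ⟨b.reverse, a.reverse, ?_, by simpa using ha⟩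
  rw [← List.reverse_reverse Z, hab]
  simp

theorem run_eq_of_common_suffix {n : ℕ} {r r' : ℕ → List ℕ} (hr : ∀ i, n ∉ r i)
    (hr' : ∀ i, n ∉ r' i) {X X' : ℕ} {Z : List ℕ} (h : Z <:+ runWord n r X)
    (h' : Z <:+ runWord n r' X') {i : ℕ} (hi : i < Z.count n) : r (X - i) = r' (X' - i) := by
  induction X generalizing X' Z i with
  | zero => simp [List.suffix_nil.1 h] at hi
  | succ X ih =>
    obtain ⟨Z₁, z, rfl, hz⟩ := exists_eq_append_cons_notMem_right
      (List.count_pos_iff.1 (by omega : 0 < Z.count n))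
    cases X' with
    | zero => simp [runWord] at h'
    | succ X' =>
      obtain ⟨U, hU⟩ := h
      obtain ⟨U', hU'⟩ := h'
      rw [← List.append_assoc] at hU hU'
      obtain ⟨h1, h2⟩ := append_cons_inj_of_notMem_right hz (hr _) hU
      obtain ⟨h1', h2'⟩ := append_cons_inj_of_notMem_right hz (hr' _) hU'
      cases i with
      | zero => simp [← h2, ← h2']
      | succ i =>
        rw [Nat.add_sub_add_right, Nat.add_sub_add_right]
        refine ih ⟨U, h1⟩ ⟨U', h1'⟩ ?_
        simp [List.count_eq_zero_of_not_mem hz] at hi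
        omega

theorem eq_runWord_append_of_isPrefix {n : ℕ} {r : ℕ → List ℕ} (hr : ∀ i, n ∉ r i) {X k : ℕ}
    {Q : List ℕ} (h : Q <+: runWord n r X) (hk : Q.count n = k + 1) :
    k + 1 ≤ X ∧ ∃ z, z <+: r (k + 1) ∧ Q = runWord n r k ++ n :: z := by
  induction X with
  | zero => simp [List.prefix_nil.1 h] at hk
  | succ X ih =>
    rcases List.prefix_or_prefix_of_prefix h (List.prefix_append (runWord n r X) _) with h1 | h1
    · exact ⟨(ih h1).1.trans (by omega), (ih h1).2⟩
    · obtain ⟨Q', rfl⟩ := h1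
      rw [runWord, List.prefix_append_right_inj] at h
      rcases List.prefix_cons_iff.1 h with rfl | ⟨z, rfl, hz⟩
      · rw [List.append_nil] at hk
        rw [List.append_nil] at ih ⊢
        exact ⟨(ih (by simp)).1.trans (by omega), (ih (by simp)).2⟩
      · have hnz : n ∉ z := fun hn => hr _ (hz.subset hn)
        have : X = k := by
          simpa [count_runWord hr, List.count_eq_zero_of_not_mem hnz] using hk
        subst this
        exact ⟨le_rfl, z, hz, rfl⟩

theorem runs_of_power_suffix {n : ℕ} {r : ℕ → List ℕ} (hr : ∀ i, n ∉ r i) {X j : ℕ} (hj : 2 ≤ j)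
    {U Y : List ℕ} (hY : n ∈ Y) (h : runWord n r X = U ++ (List.replicate j Y).flatten) :
    ∃ p, 1 ≤ p ∧ j * p ≤ X ∧ (∀ i, 0 < i → i < (j - 1) * p → r (X - i) = r (X - p - i)) ∧
      r X <+: r (X - p) := by
  obtain ⟨j, rfl⟩ : ∃ j', j = j' + 1 := ⟨j - 1, by omega⟩
  set p := Y.count n with hp
  have hp1 : 1 ≤ p := List.count_pos_iff.2 hY
  have hcount : ∀ j', ((List.replicate j' Y).flatten).count n = j' * p := by
    intro j'; simp [List.count_flatten, hp]
  have hX : X = U.count n + (j + 1) * p := by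
    have := congrArg (List.count n) h
    rwa [count_runWord hr, List.count_append, hcount] at this
  have hj1 : 1 ≤ j * p := Nat.mul_pos (by omega) hp1
  have hexp : (j + 1) * p = j * p + p := by ring
  set Q := U ++ (List.replicate j Y).flatten with hQ
  have hQpre : Q <+: runWord n r X := by
    rw [h, hQ, List.replicate_succ', List.flatten_append, ← List.append_assoc]
    exact List.prefix_append _ _
  have hQcount : Q.count n = (X - p - 1) + 1 := by
    rw [hQ, List.count_append, hcount]; omega
  obtain ⟨-, z, hz, hQz⟩ := eq_runWord_append_of_isPrefix hr hQpre hQcount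
  have hXp : X - p - 1 + 1 = X - p := by omega
  rw [hXp] at hz
  set r' : ℕ → List ℕ := fun i => if i = X - p then z else r i with hr'
  have hr'n : ∀ i, n ∉ r' i := by
    intro i
    simp only [hr']
    split_ifs
    · exact fun hn => hr _ (hz.subset hn)
    · exact hr i
  have hQ' : Q = runWord n r' (X - p) := by
    rw [hQz, ← hXp, runWord, hXp]
    congr 1
    · refine runWord_congr fun i _ hi => ?_
      simp only [hr']; rw [if_neg (by omega)]
    · simp [hr']
  have hs1 : (List.replicate j Y).flatten <:+ runWord n r X := by
    rw [h, List.replicate_succ, List.flatten_cons, ← List.append_assoc]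
    exact List.suffix_append _ _
  have hs2 : (List.replicate j Y).flatten <:+ runWord n r' (X - p) := by
    rw [← hQ']; exact List.suffix_append _ _
  have key := fun i (hi : i < j * p) =>
    run_eq_of_common_suffix hr hr'n hs1 hs2 (i := i) (by rw [hcount]; exact hi)
  refine ⟨p, hp1, by omega, fun i hi0 hi => ?_, ?_⟩
  · rw [key i (by simpa using hi)]
    simp only [hr']; rw [if_neg (by omega)]
  · have := key 0 (by omega)
    simp [hr'] at this
    rw [this]; exact hz

/-! ### Multiplicities in an arbitrary base -/

theorem pow_dvd_iff_le_multiplicity {M x : ℕ} (hM : 2 ≤ M) (hx : 0 < x) (k : ℕ) :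
    M ^ k ∣ x ↔ k ≤ multiplicity M x :=
  (Nat.finiteMultiplicity_iff.2 ⟨by omega, hx⟩).pow_dvd_iff_le_multiplicity

theorem multiplicity_eq_of_forall {M x y : ℕ} (hM : 2 ≤ M) (hx : 0 < x) (hy : 0 < y)
    (h : ∀ k, M ^ k ∣ x ↔ M ^ k ∣ y) : multiplicity M x = multiplicity M y := by
  apply le_antisymm
  · rw [← pow_dvd_iff_le_multiplicity hM hy, ← h, pow_dvd_iff_le_multiplicity hM hx]
  · rw [← pow_dvd_iff_le_multiplicity hM hx, h, pow_dvd_iff_le_multiplicity hM hy]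

theorem multiplicity_add_of_lt {M A y s : ℕ} (hM : 2 ≤ M) (hA : M ^ s ∣ A) (hy : 0 < y)
    (hys : y < M ^ s) : multiplicity M (A + y) = multiplicity M y := by
  refine multiplicity_eq_of_forall hM (by omega) hy fun k => ?_
  rcases le_or_gt k s with hk | hk
  · exact Nat.dvd_add_right ((pow_dvd_pow M hk).trans hA)
  · have h1 : ¬ M ^ s ∣ y := Nat.not_dvd_of_pos_of_lt hy hys
    have h2 : M ^ s ∣ M ^ k := pow_dvd_pow M hk.le
    constructor
    · intro h
      exact absurd ((Nat.dvd_add_right hA).1 (h2.trans h)) h1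
    · intro h
      exact absurd (h2.trans h) h1

theorem multiplicity_mul_pow {M j s : ℕ} (hM : 2 ≤ M) (hj : 0 < j) (hjM : j < M) :
    multiplicity M (j * M ^ s) = s := by
  have hpos : 0 < j * M ^ s := by positivity
  apply le_antisymm
  · by_contra! h
    have h1 := (pow_dvd_iff_le_multiplicity hM hpos _).2 h
    rw [Nat.succ_eq_add_one, pow_succ, mul_comm] at h1
    exact absurd (Nat.dvd_of_mul_dvd_mul_right (by positivity) h1)
      (Nat.not_dvd_of_pos_of_lt hj hjM)
  · rw [← pow_dvd_iff_le_multiplicity hM hpos]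
    exact Dvd.intro_left j rfl

/-- A window of the sequence `i ↦ multiplicity M i` with a period `p` repeated at least three
times contains no multiple of a higher power of `M` than `p` itself. -/
theorem not_dvd_of_multiplicity_periodic {M X j p : ℕ} (hM : 2 ≤ M) (hj : 3 ≤ j) (hp : 1 ≤ p)
    (hX : j * p ≤ X)
    (h : ∀ i, 0 < i → i < (j - 1) * p → multiplicity M (X - i) = multiplicity M (X - p - i))
    {i : ℕ} (hi0 : 0 < i) (hi : i < j * p) : ¬ M ^ (multiplicity M p + 1) ∣ X - i := by
  intro hd
  obtain ⟨j, rfl⟩ : ∃ j', j = j' + 1 := ⟨j - 1, by omega⟩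
  have hexp : (j + 1) * p = j * p + p := by ring
  have h2p : 2 * p ≤ j * p := Nat.mul_le_mul_right _ (by omega)
  simp only [Nat.add_sub_cancel] at h
  have hnp : ¬ M ^ (multiplicity M p + 1) ∣ p := by
    rw [pow_dvd_iff_le_multiplicity hM hp]; omega
  rcases lt_or_ge i (j * p) with hlt | hge
  · have h1 := h i hi0 hlt
    have h2 : M ^ (multiplicity M p + 1) ∣ X - p - i := by
      rw [pow_dvd_iff_le_multiplicity hM (by omega), ← h1,
        ← pow_dvd_iff_le_multiplicity hM (by omega)]
      exact hd
    have h3 := Nat.dvd_sub hd h2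
    rw [show X - i - (X - p - i) = p by omega] at h3
    exact hnp h3
  · have h1 := h (i - p) (by omega) (by omega)
    rw [show X - p - (i - p) = X - i by omega] at h1
    have h2 : M ^ (multiplicity M p + 1) ∣ X - (i - p) := by
      rw [pow_dvd_iff_le_multiplicity hM (by omega), h1,
        ← pow_dvd_iff_le_multiplicity hM (by omega)]
      exact hd
    have h3 := Nat.dvd_sub h2 hd
    rw [show X - (i - p) - (X - i) = p by omega] at h3
    exact hnp h3

theorem le_mod_of_not_dvd {b X l : ℕ} (h : ∀ i, i < l → ¬ b ∣ X - i) : l ≤ X % b := by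
  by_contra! hlt
  exact h _ hlt (Nat.dvd_sub_mod X)

/-! ### The prefixes `T_t` -/

/-- The set of lengths of the prefixes `T_t^(n)` is infinite. -/
def TInfinite (n : ℕ) : Prop := {k : ℕ | curl (gPrefix (n + 1) k) ≤ n}.Infinite

theorem strictMono_tau_succ {n : ℕ} (h : TInfinite n) : StrictMono fun w => tau n (w + 1) :=
  Nat.nth_strictMono h

theorem curl_Tstr_le {n : ℕ} (h : TInfinite n) (w : ℕ) : curl (Tstr n (w + 1)) ≤ n :=
  Nat.nth_mem_of_infinite h w

theorem Tstr_one {n : ℕ} (hn : 1 ≤ n) : Tstr n 1 = [] := by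
  have : tau n 1 = 0 := Nat.nth_zero_of_zero (by simpa [gPrefix, curl_nil] using hn)
  simp [Tstr, this, gPrefix]

theorem Tstr_prefix_Tstr_iff {n : ℕ} (h : TInfinite n) {u w : ℕ} :
    Tstr n (u + 1) <+: Tstr n (w + 1) ↔ u ≤ w := by
  constructor
  · intro hp
    have := hp.length_le
    simp only [Tstr, length_gPrefix] at this
    exact (strictMono_tau_succ h).le_iff_le.1 this
  · intro huw
    exact gPrefix_prefix_gPrefix _ ((strictMono_tau_succ h).monotone huw)

theorem Tstr_succ_injective {n : ℕ} (h : TInfinite n) {u w : ℕ}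
    (he : Tstr n (u + 1) = Tstr n (w + 1)) : u = w :=
  le_antisymm ((Tstr_prefix_Tstr_iff h).1 (he ▸ List.prefix_refl _))
    ((Tstr_prefix_Tstr_iff h).1 (he ▸ List.prefix_refl _))

theorem notMem_Tstr (n t : ℕ) : n ∉ Tstr n t := fun h => by
  have := le_of_mem_gPrefix h; omega

/-! ### Ruler words -/

/-- The maximal run without the letter `n` which follows the `i`-th letter `n` in `A^(n)`. -/
noncomputable def rulerRun (n i : ℕ) : List ℕ := Tstr n (multiplicity (n + 1) i + 1)

/-- The prefix of `A^(n)` preceding its `(x+1)`-st letter `n`. -/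
noncomputable def rulerWord (n x : ℕ) : List ℕ := runWord n (rulerRun n) x

theorem rulerWord_zero (n : ℕ) : rulerWord n 0 = [] := rfl

theorem rulerWord_succ (n x : ℕ) :
    rulerWord n (x + 1) = rulerWord n x ++ n :: rulerRun n (x + 1) := rfl

theorem notMem_rulerRun (n i : ℕ) : n ∉ rulerRun n i := notMem_Tstr _ _

theorem rulerRun_suffix_rulerWord {n x : ℕ} (hx : 0 < x) : rulerRun n x <:+ rulerWord n x := by
  obtain ⟨x, rfl⟩ := Nat.exists_eq_add_of_lt hx
  rw [zero_add, rulerWord_succ]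
  exact ⟨rulerWord n x ++ [n], by simp⟩

theorem count_rulerWord (n x : ℕ) : (rulerWord n x).count n = x :=
  count_runWord (notMem_rulerRun n) x

theorem rulerWord_prefix_rulerWord (n : ℕ) {x y : ℕ} (h : x ≤ y) :
    rulerWord n x <+: rulerWord n y := by
  induction y, h using Nat.le_induction with
  | base => exact List.prefix_refl _
  | succ y _ ih => exact ih.trans (List.prefix_append _ _)

theorem strictMono_length_rulerWord (n : ℕ) : StrictMono fun x => (rulerWord n x).length :=
  strictMono_nat_of_lt_succ fun x => by simp [rulerWord_succ]

theorem rulerWord_add {n s A y : ℕ} (hn : 1 ≤ n) (hA : (n + 1) ^ s ∣ A) (hy : y < (n + 1) ^ s) :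
    rulerWord n (A + y) = rulerWord n A ++ rulerWord n y := by
  induction y with
  | zero => simp [rulerWord_zero]
  | succ y ih =>
    rw [← add_assoc, rulerWord_succ, ih (by omega), rulerWord_succ, rulerRun, rulerRun, add_assoc,
      multiplicity_add_of_lt (by omega) hA (by omega) hy, List.append_assoc]

theorem rulerWord_mul_pow {n s j : ℕ} (hn : 1 ≤ n) (hj : j ≤ n) :
    rulerWord n (j * (n + 1) ^ s) = (List.replicate j (rulerWord n ((n + 1) ^ s))).flatten := by
  induction j with
  | zero => simp [rulerWord_zero]
  | succ j ih =>
    rw [List.replicate_succ', List.flatten_append, ← ih (by omega), List.flatten_singleton]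
    have hpos : 0 < (n + 1) ^ s := by positivity
    obtain ⟨y, hy⟩ : ∃ y, (n + 1) ^ s = y + 1 := ⟨(n + 1) ^ s - 1, by omega⟩
    have h1 : (j + 1) * (n + 1) ^ s = (j * (n + 1) ^ s + y) + 1 := by rw [add_mul, one_mul]; omega
    have h2 : rulerRun n ((j + 1) * (n + 1) ^ s) = rulerRun n ((n + 1) ^ s) := by
      rw [rulerRun, rulerRun, multiplicity_mul_pow (by omega) (by omega) (by omega),
        ← one_mul ((n + 1) ^ s), multiplicity_mul_pow (by omega) (by omega) (by omega)]
    rw [h1, rulerWord_succ, ← h1, h2, rulerWord_add hn (Dvd.intro_left j rfl) (by omega)]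
    conv_rhs => rw [hy, rulerWord_succ, ← hy]
    rw [List.append_assoc]

theorem rulerWord_ne_nil {n x : ℕ} (hx : 0 < x) : rulerWord n x ≠ [] := by
  obtain ⟨x, rfl⟩ := Nat.exists_eq_add_of_lt hx
  simp [rulerWord_succ]

theorem flatten_replicate_append_rotate (P R : List ℕ) (d : ℕ) :
    (List.replicate d (P ++ R)).flatten ++ P = P ++ (List.replicate d (R ++ P)).flatten := by
  induction d with
  | zero => simp
  | succ d ih => simp [List.replicate_succ, ih]

theorem digit_le_curl_rulerWord {n x s : ℕ} (hn : 1 ≤ n) (hd : 2 ≤ x / (n + 1) ^ s % (n + 1)) :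
    x / (n + 1) ^ s % (n + 1) ≤ curl (rulerWord n x) := by
  set M := n + 1 with hM
  set d := x / M ^ s % M with hdef
  have hdM : d < M := Nat.mod_lt _ (by omega)
  set lo := x % M ^ s with hlo
  have hlo' : lo < M ^ s := Nat.mod_lt _ (by positivity)
  have h1 : x = M ^ (s + 1) * (x / M ^ (s + 1)) + (d * M ^ s + lo) := by
    have e1 := Nat.div_add_mod x (M ^ s)
    have e2 := Nat.div_add_mod (x / M ^ s) M
    rw [Nat.div_div_eq_div_mul] at e2
    rw [pow_succ]
    have e3 : ∀ A B q d' lo' y z : ℕ, A * y + lo' = z → B * q + d' = y →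
        z = A * B * q + (d' * A + lo') := by
      rintro A B q d' lo' y z rfl rfl; ring
    exact e3 _ _ _ _ _ _ _ e1 e2
  have h2 : d * M ^ s + lo < M ^ (s + 1) := by
    have : (d + 1) * M ^ s ≤ M * M ^ s := Nat.mul_le_mul_right _ hdM
    rw [pow_succ]; nlinarith
  have h3 : rulerWord n x = rulerWord n (M ^ (s + 1) * (x / M ^ (s + 1))) ++
      ((List.replicate d (rulerWord n (M ^ s))).flatten ++ rulerWord n lo) := by
    conv_lhs => rw [h1]
    rw [rulerWord_add hn (Dvd.intro _ rfl) h2, rulerWord_add hn (Dvd.intro_left _ rfl) hlo',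
      rulerWord_mul_pow hn (by omega)]
  obtain ⟨R, hR⟩ := rulerWord_prefix_rulerWord n hlo'.le
  rw [← hR, flatten_replicate_append_rotate, ← List.append_assoc] at h3
  refine (le_curl_iff hd).2 ⟨_, R ++ rulerWord n lo, ?_, h3⟩
  intro hnil
  have hne := rulerWord_ne_nil (n := n) (pow_pos (by omega : 0 < M) s)
  rw [← hR] at hne
  rw [List.append_eq_nil_iff] at hnil
  exact hne (by rw [hnil.1, hnil.2, List.append_nil])

theorem flatten_replicate_suffix_of_notMem {n : ℕ} {A Z U Y : List ℕ} {j : ℕ} (hY : n ∉ Y)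
    (h : A ++ n :: Z = U ++ (List.replicate j Y).flatten) :
    (List.replicate j Y).flatten <:+ Z := by
  have hn : n ∉ (List.replicate j Y).flatten := by
    intro hn
    obtain ⟨l, hl, hnl⟩ := List.mem_flatten.1 hn
    exact hY ((List.mem_replicate.1 hl).2 ▸ hnl)
  have h1 : Z <:+ A ++ n :: Z := ⟨A ++ [n], by simp⟩
  have h2 : (List.replicate j Y).flatten <:+ A ++ n :: Z := ⟨U, h.symm⟩
  rcases List.suffix_or_suffix_of_suffix h1 h2 with hs | hs
  · obtain ⟨e, he⟩ := hs
    rcases List.eq_nil_or_concat e with rfl | ⟨e, b, rfl⟩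
    · rw [← he]; exact List.suffix_refl _
    · rw [← he, ← List.append_assoc] at h
      have h2 := List.append_cancel_right (show (A ++ [n]) ++ Z = (U ++ (e ++ [b])) ++ Z by
        simpa using h)
      rw [← List.append_assoc] at h2
      have : n = b := by simpa using (List.append_inj' h2 rfl).2
      subst this
      exact absurd (by rw [← he]; simp) hn
  · exact hs

/-- A power of exponent at least three which contains the letter `n` and ends a word
`rulerWord n x ++ n :: Z`. -/
theorem exponent_bounds_of_power_suffix {n x j : ℕ} (hn : 1 ≤ n) (hT : TInfinite n) (hj : 3 ≤ j)
    {Z U Y : List ℕ} (hZ : Z <+: rulerRun n (x + 1)) (hY : n ∈ Y)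
    (h : rulerWord n x ++ n :: Z = U ++ (List.replicate j Y).flatten) :
    j ≤ n + 1 ∧ (Z = rulerRun n (x + 1) → ∃ s, j ≤ (x + 1) / (n + 1) ^ s % (n + 1)) := by
  set r : ℕ → List ℕ := fun i => if i = x + 1 then Z else rulerRun n i with hr
  have hrn : ∀ i, n ∉ r i := by
    intro i
    simp only [hr]
    split_ifs
    · exact fun hn => notMem_rulerRun _ _ (hZ.subset hn)
    · exact notMem_rulerRun _ _
  have hword : rulerWord n x ++ n :: Z = runWord n r (x + 1) := by
    rw [runWord]
    congr 1
    · refine runWord_congr fun i _ hi => ?_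
      simp only [hr]; rw [if_neg (by omega)]
    · simp [hr]
  rw [hword] at h
  obtain ⟨p, hp1, hpX, hper, hlast⟩ := runs_of_power_suffix hrn (by omega) hY h
  have h3p : 3 * p ≤ j * p := Nat.mul_le_mul_right _ hj
  have hper' : ∀ i, 0 < i → i < (j - 1) * p →
      multiplicity (n + 1) (x + 1 - i) = multiplicity (n + 1) (x + 1 - p - i) := by
    intro i hi0 hi
    have h1 := hper i hi0 hi
    simp only [hr] at h1
    rw [if_neg (by omega), if_neg (by omega)] at h1
    exact Tstr_succ_injective hT h1
  have hnd := fun i hi0 hi =>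
    not_dvd_of_multiplicity_periodic (by omega) hj hp1 hpX hper' (i := i) hi0 hi
  set c := multiplicity (n + 1) p with hc
  have hpc : (n + 1) ^ c ≤ p :=
    Nat.le_of_dvd hp1 ((pow_dvd_iff_le_multiplicity (by omega) hp1 _).2 le_rfl)
  have hjpc : j * (n + 1) ^ c ≤ j * p := Nat.mul_le_mul_left _ hpc
  have hpos : 0 < (n + 1) ^ c := by positivity
  constructor
  · by_contra! hlt
    have h1 : (n + 1 + 1) * (n + 1) ^ c ≤ j * p :=
      (Nat.mul_le_mul_right _ (by omega)).trans hjpc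
    have h2 : (n + 1) ^ (c + 1) < j * p := by rw [pow_succ]; nlinarith
    rcases eq_or_ne ((x + 1) % (n + 1) ^ (c + 1)) 0 with h0 | h0
    · refine hnd ((n + 1) ^ (c + 1)) (by positivity) h2 ?_
      exact Nat.dvd_sub (Nat.dvd_of_mod_eq_zero h0) dvd_rfl
    · exact hnd _ (Nat.pos_of_ne_zero h0)
        ((Nat.mod_lt _ (by positivity)).trans h2) (Nat.dvd_sub_mod _)
  · rintro rfl
    have hXd : ¬ (n + 1) ^ (c + 1) ∣ x + 1 := by
      intro hd
      have h1 : r (x + 1) = rulerRun n (x + 1) := by simp [hr]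
      have h2 : r (x + 1 - p) = rulerRun n (x + 1 - p) := by
        simp only [hr]; rw [if_neg (by omega)]
      rw [h1, h2, rulerRun, rulerRun, Tstr_prefix_Tstr_iff hT] at hlast
      have h3 : (n + 1) ^ (c + 1) ∣ x + 1 - p := by
        rw [pow_dvd_iff_le_multiplicity (by omega) (by omega)] at hd ⊢
        exact hd.trans hlast
      have h4 := Nat.dvd_sub hd h3
      rw [show x + 1 - (x + 1 - p) = p by omega,
        pow_dvd_iff_le_multiplicity (by omega) hp1] at h4
      omega
    refine ⟨c, ?_⟩
    have h1 : j * p ≤ (x + 1) % (n + 1) ^ (c + 1) := by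
      refine le_mod_of_not_dvd fun i hi => ?_
      rcases Nat.eq_zero_or_pos i with rfl | hi0
      · exact hXd
      · exact hnd i hi0 hi
    rw [← Nat.mod_mul_right_div_self, ← pow_succ, Nat.le_div_iff_mul_le hpos]
    exact hjpc.trans h1

theorem curl_rulerWord_le_iff {n x c : ℕ} (hn : 1 ≤ n) (hT : TInfinite n) (hc : 2 ≤ c) :
    curl (rulerWord n x) ≤ c ↔
      x = 0 ∨ ((∀ s, x / (n + 1) ^ s % (n + 1) ≤ c) ∧ curl (rulerRun n x) ≤ c) := by
  rcases Nat.eq_zero_or_pos x with rfl | hx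
  · simp [rulerWord_zero, curl_nil]; omega
  constructor
  · intro h
    refine Or.inr ⟨fun s => ?_, (curl_le_of_suffix (rulerRun_suffix_rulerWord hx)).trans h⟩
    by_contra! hlt
    exact absurd ((digit_le_curl_rulerWord hn (by omega)).trans h) (not_le.2 hlt)
  · rintro (h | ⟨hdig, hrun⟩)
    · omega
    by_contra! hlt
    obtain ⟨x, rfl⟩ : ∃ y, x = y + 1 := ⟨x - 1, by omega⟩
    obtain ⟨U, Y, hY, h⟩ := (le_curl_iff (j := c + 1) (by omega)).1 hlt
    rw [rulerWord_succ] at h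
    by_cases hnY : n ∈ Y
    · obtain ⟨s, hs⟩ := (exponent_bounds_of_power_suffix hn hT (by omega)
        (List.prefix_refl _) hnY h).2 rfl
      exact absurd (hs.trans (hdig s)) (by omega)
    · obtain ⟨W, hW⟩ := flatten_replicate_suffix_of_notMem hnY h
      exact absurd ((le_curl_iff (j := c + 1) (by omega)).2 ⟨W, Y, hY, hW.symm⟩) (by omega)

/-! ### Ruler words are the prefixes of the Gijswijt sequence -/

theorem gPrefix_length_concat {m a : ℕ} {P : List ℕ} (hP : gPrefix m P.length = P)
    (ha : max m (curl P) = a) : gPrefix m (P ++ [a]).length = P ++ [a] := by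
  simp [gPrefix, hP, ha]

theorem curl_rulerWord_le {n x : ℕ} (hn : 2 ≤ n) (hT : TInfinite n) :
    curl (rulerWord n x) ≤ n := by
  rw [curl_rulerWord_le_iff (by omega) hT hn]
  exact Or.inr ⟨fun s => Nat.lt_succ_iff.1 (Nat.mod_lt _ (by omega)), curl_Tstr_le hT _⟩

theorem rulerWord_append_eq_append_power {n x w : ℕ} (hn : 1 ≤ n)
    (hw : w < multiplicity (n + 1) (x + 1)) :
    ∃ A, rulerWord n x ++ n :: Tstr n (w + 1) =
      A ++ (List.replicate (n + 1) (rulerWord n ((n + 1) ^ w))).flatten := by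
  have hpos : 0 < (n + 1) ^ w := by positivity
  have hd : (n + 1) ^ (w + 1) ∣ x + 1 := by
    rw [pow_dvd_iff_le_multiplicity (by omega) (by omega)]; omega
  have hle := Nat.le_of_dvd (by omega) hd
  have hexp : (n + 1) ^ (w + 1) = n * (n + 1) ^ w + (n + 1) ^ w := by rw [pow_succ]; ring
  obtain ⟨A, hA⟩ : ∃ A, x + 1 = A + (n + 1) ^ (w + 1) := ⟨x + 1 - (n + 1) ^ (w + 1), by omega⟩
  have hAd : (n + 1) ^ (w + 1) ∣ A := by
    rw [hA] at hd; exact (Nat.dvd_add_left dvd_rfl).1 hd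
  have hx : x = A + (n * (n + 1) ^ w + ((n + 1) ^ w - 1)) := by omega
  have hblock : rulerWord n ((n + 1) ^ w) = rulerWord n ((n + 1) ^ w - 1) ++ n :: Tstr n (w + 1) := by
    conv_lhs => rw [show (n + 1) ^ w = (n + 1) ^ w - 1 + 1 by omega, rulerWord_succ]
    rw [show (n + 1) ^ w - 1 + 1 = 1 * (n + 1) ^ w by omega, rulerRun,
      multiplicity_mul_pow (by omega) one_pos (by omega)]
  refine ⟨rulerWord n A, ?_⟩
  rw [hx, rulerWord_add hn hAd (by omega),
    rulerWord_add hn (Dvd.intro_left n rfl) (by omega), rulerWord_mul_pow hn le_rfl,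
    List.replicate_succ', List.flatten_append, List.flatten_singleton, List.append_assoc,
    List.append_assoc, ← hblock]

theorem max_curl_rulerWord_append {n x l : ℕ} (hn : 2 ≤ n) (hT : TInfinite n)
    (hl : l < tau n (multiplicity (n + 1) (x + 1) + 1)) :
    max n (curl (rulerWord n x ++ n :: gPrefix (n + 1) l)) =
      max (n + 1) (curl (gPrefix (n + 1) l)) := by
  have hsuff : curl (gPrefix (n + 1) l) ≤ curl (rulerWord n x ++ n :: gPrefix (n + 1) l) :=
    curl_le_of_suffix ⟨rulerWord n x ++ [n], by simp⟩
  apply le_antisymm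
  · refine max_le (by omega) ?_
    by_contra! hlt
    have hlt' := max_lt_iff.1 hlt
    obtain ⟨U, Y, hY, h⟩ := (le_curl_iff
      (S := rulerWord n x ++ n :: gPrefix (n + 1) l) (by omega)).1 le_rfl
    by_cases hnY : n ∈ Y
    · have := (exponent_bounds_of_power_suffix (by omega) hT (by omega)
        (gPrefix_prefix_gPrefix _ hl.le) hnY h).1
      omega
    · obtain ⟨W, hW⟩ := flatten_replicate_suffix_of_notMem hnY h
      have := (le_curl_iff (by omega)).2 ⟨W, Y, hY, hW.symm⟩
      omega
  · refine max_le ?_ (hsuff.trans (le_max_right _ _))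
    by_cases hc : curl (gPrefix (n + 1) l) ≤ n
    · obtain ⟨w, hw⟩ : l ∈ Set.range (Nat.nth fun k => curl (gPrefix (n + 1) k) ≤ n) := by
        rw [Nat.range_nth_of_infinite hT]; exact hc
      have hwlt : w < multiplicity (n + 1) (x + 1) := by
        rw [← hw] at hl
        exact (Nat.nth_lt_nth hT).1 hl
      obtain ⟨A, hA⟩ := rulerWord_append_eq_append_power (by omega) hwlt
      have hTl : Tstr n (w + 1) = gPrefix (n + 1) l := by rw [← hw]; rfl
      rw [hTl] at hA
      exact ((le_curl_iff (by omega)).2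
        ⟨A, _, rulerWord_ne_nil (by positivity), hA⟩).trans (le_max_right _ _)
    · omega

theorem gPrefix_length_rulerWord_append {n x : ℕ} (hn : 2 ≤ n) (hT : TInfinite n)
    (hx : gPrefix n (rulerWord n x).length = rulerWord n x) {l : ℕ}
    (hl : l ≤ tau n (multiplicity (n + 1) (x + 1) + 1)) :
    gPrefix n (rulerWord n x ++ n :: gPrefix (n + 1) l).length =
      rulerWord n x ++ n :: gPrefix (n + 1) l := by
  induction l with
  | zero => exact gPrefix_length_concat hx (max_eq_left (curl_rulerWord_le hn hT))
  | succ l ih =>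
    have h := gPrefix_length_concat (ih (by omega)) (max_curl_rulerWord_append hn hT hl)
    simpa [gPrefix] using h

theorem gPrefix_length_rulerWord {n : ℕ} (hn : 2 ≤ n) (hT : TInfinite n) (x : ℕ) :
    gPrefix n (rulerWord n x).length = rulerWord n x := by
  induction x with
  | zero => rfl
  | succ x ih => exact gPrefix_length_rulerWord_append hn hT ih le_rfl

theorem exists_length_rulerWord_eq {n c k : ℕ} (hn : 2 ≤ n) (hc : c ≤ n) (hT : TInfinite n)
    (hk : curl (gPrefix n k) ≤ c) : ∃ x, (rulerWord n x).length = k := by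
  have hmono := strictMono_length_rulerWord n
  obtain ⟨x, hx1, hx2⟩ : ∃ x, (rulerWord n x).length ≤ k ∧ k < (rulerWord n (x + 1)).length := by
    have hex : ∃ y, k < (rulerWord n y).length := ⟨k + 1, hmono.le_apply⟩
    have hpos : Nat.find hex ≠ 0 := fun h0 => by
      have := Nat.find_spec hex
      rw [h0] at this; simp [rulerWord_zero] at this
    refine ⟨Nat.find hex - 1, ?_, ?_⟩
    · exact not_lt.1 (Nat.find_min hex (by omega))
    · rw [Nat.sub_add_cancel (by omega)]; exact Nat.find_spec hex
  rcases hx1.eq_or_lt with h | h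
  · exact ⟨x, h⟩
  exfalso
  rw [rulerWord_succ] at hx2
  simp only [List.length_append, List.length_cons, rulerRun, Tstr, length_gPrefix] at hx2
  obtain ⟨l, rfl⟩ := Nat.exists_eq_add_of_lt h
  have hl : l < tau n (multiplicity (n + 1) (x + 1) + 1) := by omega
  have h1 := gPrefix_length_rulerWord_append hn hT (gPrefix_length_rulerWord hn hT x) hl.le
  simp only [List.length_append, List.length_cons, length_gPrefix] at h1
  rw [← add_assoc] at h1
  rw [h1] at hk
  have h2 := max_curl_rulerWord_append hn hT hl
  have h3 : n < max n (curl (rulerWord n x ++ n :: gPrefix (n + 1) l)) := by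
    rw [h2]; exact lt_of_lt_of_le (Nat.lt_succ_self n) (le_max_left _ _)
  rcases lt_max_iff.1 h3 with h3 | h3 <;> omega

/-- The number of letters `n` in the `v`-th prefix of `A^(n)` with curling number at most `c`. -/
noncomputable def rulerNth (n c v : ℕ) : ℕ := Nat.nth (fun x => curl (rulerWord n x) ≤ c) v

theorem infinite_curl_rulerWord_le {n c : ℕ} (hn : 2 ≤ n) (hc : c ≤ n) (hT : TInfinite n)
    (h : {k | curl (gPrefix n k) ≤ c}.Infinite) : {x | curl (rulerWord n x) ≤ c}.Infinite := by
  intro hfin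
  refine h ((hfin.image fun x => (rulerWord n x).length).subset fun k hk => ?_)
  obtain ⟨x, rfl⟩ := exists_length_rulerWord_eq hn hc hT hk
  refine ⟨x, ?_, rfl⟩
  simpa [gPrefix_length_rulerWord hn hT x] using hk

/-- The strings `T_t^(n)` at level `n` are ruler words of level `n + 1`. -/
theorem Tstr_eq_rulerWord {n : ℕ} (hn : 1 ≤ n) (h0 : TInfinite n) (h1 : TInfinite (n + 1)) (v : ℕ) :
    Tstr n (v + 1) = rulerWord (n + 1) (rulerNth (n + 1) n v) := by
  have key := Nat.nth_comp_of_strictMono (p := fun k => curl (gPrefix (n + 1) k) ≤ n) (n := v)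
    (strictMono_length_rulerWord (n + 1))
    (fun k hk => exists_length_rulerWord_eq (by omega) (by omega) h1 hk)
    (fun hfi => absurd hfi h0)
  simp only [gPrefix_length_rulerWord (show 2 ≤ n + 1 by omega) h1] at key
  rw [Tstr, tau, Nat.add_sub_cancel, ← key]
  exact gPrefix_length_rulerWord (by omega) h1 _

/-! ### Counting positions with small curling number -/

theorem add_div_pow_mod {M k j y s : ℕ} (hj : j < M) (hy : y < M ^ k) :
    (j * M ^ k + y) / M ^ s % M = if s < k then y / M ^ s % M else if s = k then j else 0 := by
  have hM : 0 < M := by omega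
  split_ifs with h1 h2
  · obtain ⟨d, rfl⟩ := Nat.exists_eq_add_of_lt h1
    have : j * M ^ (s + d + 1) + y = y + M ^ s * (M * (j * M ^ d)) := by ring
    rw [this, Nat.add_mul_div_left _ _ (by positivity), Nat.add_mul_mod_self_left]
  · subst h2
    rw [add_comm, Nat.add_mul_div_right _ _ (by positivity), Nat.div_eq_of_lt hy, zero_add,
      Nat.mod_eq_of_lt hj]
  · have : j * M ^ k + y < M ^ s := by
      calc j * M ^ k + y < (j + 1) * M ^ k := by rw [add_mul, one_mul]; omega
        _ ≤ M * M ^ k := Nat.mul_le_mul_right _ hj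
        _ = M ^ (k + 1) := by ring
        _ ≤ M ^ s := Nat.pow_le_pow_right hM (by omega)
    rw [Nat.div_eq_of_lt this, Nat.zero_mod]

theorem curl_rulerWord_block_add_le_iff {n c k j y : ℕ} (hn : 1 ≤ n) (hT : TInfinite n) (hc : 2 ≤ c)
    (hj : j ≤ n) (hy0 : 0 < y) (hy : y < (n + 1) ^ k) :
    curl (rulerWord n (j * (n + 1) ^ k + y)) ≤ c ↔ j ≤ c ∧ curl (rulerWord n y) ≤ c := by
  have hrun : rulerRun n (j * (n + 1) ^ k + y) = rulerRun n y := by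
    rw [rulerRun, rulerRun, multiplicity_add_of_lt (by omega) (Dvd.intro_left _ rfl) hy0 hy]
  have hdig : ∀ s, k ≤ s → y / (n + 1) ^ s % (n + 1) = 0 := fun s hs => by
    rw [Nat.div_eq_of_lt (hy.trans_le (Nat.pow_le_pow_right (by omega) hs)), Nat.zero_mod]
  rw [curl_rulerWord_le_iff hn hT hc, curl_rulerWord_le_iff hn hT hc, hrun]
  simp only [add_div_pow_mod (Nat.lt_succ_of_le hj) hy, show j * (n + 1) ^ k + y ≠ 0 by omega,
    hy0.ne', false_or]
  constructor
  · rintro ⟨h1, h2⟩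
    refine ⟨by simpa using h1 k, fun s => ?_, h2⟩
    by_cases hs : s < k
    · simpa [hs] using h1 s
    · rw [hdig s (by omega)]; omega
  · rintro ⟨h1, h2, h3⟩
    refine ⟨fun s => ?_, h3⟩
    split_ifs
    · exact h2 s
    · exact h1
    · omega

theorem curl_rulerWord_block_le_iff {n c k j : ℕ} (hn : 1 ≤ n) (hT : TInfinite n) (hc : 2 ≤ c)
    (hj0 : 0 < j) (hj : j ≤ n) :
    curl (rulerWord n (j * (n + 1) ^ k)) ≤ c ↔ j ≤ c ∧ curl (Tstr n (k + 1)) ≤ c := by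
  have hpos : 0 < (n + 1) ^ k := by positivity
  have hdig : ∀ s, j * (n + 1) ^ k / (n + 1) ^ s % (n + 1) = if s = k then j else 0 := fun s => by
    have := add_div_pow_mod (s := s) (Nat.lt_succ_of_le hj) hpos
    simp only [add_zero, Nat.zero_div, Nat.zero_mod] at this
    rw [this]
    split_ifs <;> omega
  rw [curl_rulerWord_le_iff hn hT hc, rulerRun, multiplicity_mul_pow (by omega) hj0 (by omega)]
  have h0 : j * (n + 1) ^ k ≠ 0 := (Nat.mul_pos hj0 hpos).ne'
  simp only [hdig, h0, false_or]
  refine and_congr_left fun _ => ⟨fun h => by simpa using h k, fun h s => ?_⟩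
  split_ifs <;> omega

/-- The number of positive `x < (n + 1) ^ k` for which the curling number of the prefix
preceding the `(x+1)`-st letter `n` is less than `n`. -/
noncomputable def blockCount (n k : ℕ) : ℕ :=
  Nat.count (fun x => curl (rulerWord n x) ≤ n - 1) ((n + 1) ^ k) - 1

theorem count_pos_of_pos {n c N : ℕ} (hc : 1 ≤ c) (hN : 0 < N) :
    1 ≤ Nat.count (fun x => curl (rulerWord n x) ≤ c) N := by
  obtain ⟨N, rfl⟩ := Nat.exists_eq_add_of_lt hN
  rw [zero_add, Nat.count_succ', if_pos (by simpa [rulerWord_zero, curl_nil] using hc)]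
  omega

theorem count_block_add {n k j y : ℕ} (hn : 3 ≤ n) (hT : TInfinite n) (hj0 : 0 < j)
    (hj : j < n) (hy0 : 0 < y) (hy : y ≤ (n + 1) ^ k) :
    Nat.count (fun x => curl (rulerWord n x) ≤ n - 1) (j * (n + 1) ^ k + y) + 1 =
      Nat.count (fun x => curl (rulerWord n x) ≤ n - 1) (j * (n + 1) ^ k) +
      Nat.count (fun x => curl (rulerWord n x) ≤ n - 1) y +
      (if curl (Tstr n (k + 1)) ≤ n - 1 then 1 else 0) := by
  rw [Nat.count_add]
  induction y, hy0 using Nat.le_induction with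
  | base =>
    have hb := curl_rulerWord_block_le_iff (k := k) (c := n - 1) (by omega : 1 ≤ n) hT (by omega)
      hj0 hj.le
    have h0 : curl (rulerWord n 0) ≤ n - 1 := by rw [rulerWord_zero, curl_nil]; omega
    have hj' : j ≤ n - 1 := by omega
    simp only [Nat.count_succ, Nat.count_zero, add_zero, hb, h0, hj', true_and, if_true]
    ring
  | succ y hy0 ih =>
    have hb := curl_rulerWord_block_add_le_iff (c := n - 1) (by omega : 1 ≤ n) hT (by omega)
      hj.le hy0 (by omega : y < (n + 1) ^ k)
    have hj' : j ≤ n - 1 := by omega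
    have := ih (by omega)
    simp only [Nat.count_succ, hb, hj', true_and]
    omega

theorem count_mul_pow {n k j : ℕ} (hn : 3 ≤ n) (hT : TInfinite n) (hj0 : 0 < j) (hj : j ≤ n) :
    Nat.count (fun x => curl (rulerWord n x) ≤ n - 1) (j * (n + 1) ^ k) +
      (if curl (Tstr n (k + 1)) ≤ n - 1 then 1 else 0) = 
      j * (blockCount n k + (if curl (Tstr n (k + 1)) ≤ n - 1 then 1 else 0)) + 1 := by
  have hpos : 0 < (n + 1) ^ k := by positivity
  have h1 := count_pos_of_pos (n := n) (c := n - 1) (by omega) hpos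
  induction j, hj0 using Nat.le_induction with
  | base => rw [blockCount]; simp only [Nat.succ_eq_add_one, zero_add, one_mul]; omega
  | succ j hj0 ih =>
    have h2 := count_block_add hn hT hj0 (by omega : j < n) hpos le_rfl
    have h3 := ih (by omega)
    rw [add_mul, one_mul, add_mul]
    rw [blockCount] at h3 ⊢
    omega

theorem lt_curl_rulerWord_top_block {n k y : ℕ} (hn : 3 ≤ n) (hT : TInfinite n)
    (hy : y < (n + 1) ^ k) : ¬ curl (rulerWord n (n * (n + 1) ^ k + y)) ≤ n - 1 := by
  rcases Nat.eq_zero_or_pos y with rfl | hy0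
  · rw [add_zero, curl_rulerWord_block_le_iff (by omega) hT (by omega) (by omega) le_rfl]; omega
  · rw [curl_rulerWord_block_add_le_iff (by omega) hT (by omega) le_rfl hy0 hy]; omega

theorem count_pow_succ {n k : ℕ} (hn : 3 ≤ n) (hT : TInfinite n) :
    Nat.count (fun x => curl (rulerWord n x) ≤ n - 1) ((n + 1) ^ (k + 1)) =
      Nat.count (fun x => curl (rulerWord n x) ≤ n - 1) (n * (n + 1) ^ k) := by
  have key : ∀ y ≤ (n + 1) ^ k, 
      Nat.count (fun x => curl (rulerWord n x) ≤ n - 1) (n * (n + 1) ^ k + y) =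
      Nat.count (fun x => curl (rulerWord n x) ≤ n - 1) (n * (n + 1) ^ k) := fun y => by
    induction y with
    | zero => intro _; rfl
    | succ y ih =>
      intro hy
      rw [← add_assoc, Nat.count_succ, if_neg (lt_curl_rulerWord_top_block hn hT hy), add_zero,
        ih (by omega)]
  rw [← key _ le_rfl, pow_succ]
  congr 1
  ring

theorem blockCount_zero (n : ℕ) : blockCount n 0 = 0 := by
  have := Nat.count_le (p := fun x => curl (rulerWord n x) ≤ n - 1) (n := 1)
  simp only [blockCount, pow_zero]
  omega

theorem blockCount_succ {n k : ℕ} (hn : 3 ≤ n) (hT : TInfinite n) :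
    blockCount n (k + 1) =
      n * blockCount n k + (n - 1) * (if curl (Tstr n (k + 1)) ≤ n - 1 then 1 else 0) := by
  have h := count_mul_pow (k := k) hn hT (by omega) (le_refl n)
  rw [← count_pow_succ hn hT] at h
  rw [blockCount]
  obtain ⟨l, rfl⟩ := Nat.exists_eq_add_of_le' (show 1 ≤ n by omega)
  rw [Nat.add_sub_cancel] at h ⊢
  generalize (if curl (Tstr (l + 1) (k + 1)) ≤ l then 1 else 0) = d at h ⊢
  have : (l + 1) * (blockCount (l + 1) k + d) = (l + 1) * blockCount (l + 1) k + l * d + d := by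
    ring
  omega

theorem count_pow_eq_blockCount {n : ℕ} (hn : 2 ≤ n) (k : ℕ) :
    Nat.count (fun x => curl (rulerWord n x) ≤ n - 1) ((n + 1) ^ k) = blockCount n k + 1 := by
  have := count_pos_of_pos (n := n) (c := n - 1) (N := (n + 1) ^ k) (by omega) (by positivity)
  rw [blockCount]; omega

/-! ### The limit of `x / ι(x)` as a series -/

theorem ofDigits_digits_pow_le_iff {m x : ℕ} (hm : 1 ≤ m)
    (hx : ∀ s, x / (m + 2) ^ s % (m + 2) ≤ m) (K : ℕ) :
    (m + 1) ^ K ≤ Nat.ofDigits (m + 1) (Nat.digits (m + 2) x) ↔ (m + 2) ^ K ≤ x := by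
  have hdig : Nat.digits (m + 1) (Nat.ofDigits (m + 1) (Nat.digits (m + 2) x)) =
      Nat.digits (m + 2) x := by
    refine Nat.digits_ofDigits _ (by omega) _ (fun d hd => ?_) fun h => ?_
    · obtain ⟨i, hi, rfl⟩ := List.mem_iff_getElem.1 hd
      have := hx i
      rw [← Nat.getD_digits _ _ (by omega), List.getD_eq_getElem _ _ hi] at this
      omega
    · exact Nat.getLast_digit_ne_zero _ fun hx0 => h (by simp [hx0])
  rw [← Nat.lt_digits_length_iff (by omega), ← Nat.lt_digits_length_iff (by omega), hdig]

theorem pow_le_iota_succ_iff {m : ℕ} (hm : 2 ≤ m) (h0 : TInfinite m) (h1 : TInfinite (m + 1))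
    (v K : ℕ) : (m + 1) ^ K ≤ iota m (v + 1) ↔ (m + 2) ^ K ≤ rulerNth (m + 1) m v := by
  rw [iota, Tstr_eq_rulerWord (by omega) h0 h1, count_rulerWord]
  refine ofDigits_digits_pow_le_iff (by omega) (fun s => ?_) K
  have hmem : curl (rulerWord (m + 1) (rulerNth (m + 1) m v)) ≤ m :=
    Nat.nth_mem_of_infinite (infinite_curl_rulerWord_le (by omega) (by omega) h1 h0) v
  rcases (curl_rulerWord_le_iff (by omega) h1 hm).1 hmem with h | ⟨h, -⟩
  · simp [h]
  · exact h s

theorem self_le_blockCount {n : ℕ} (hn : 3 ≤ n) (hT : TInfinite n) (K : ℕ) :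
    K ≤ blockCount n K := by
  induction K with
  | zero => simp
  | succ K ih =>
    rw [blockCount_succ hn hT]
    rcases Nat.eq_zero_or_pos K with rfl | hK
    · simp only [zero_add, Tstr_one (show 1 ≤ n by omega), curl_nil, show 1 ≤ n - 1 by omega, if_true]
      omega
    · nlinarith [Nat.zero_le ((n - 1) * (if curl (Tstr n (K + 1)) ≤ n - 1 then 1 else 0))]

theorem tendsto_blockCount_div {m : ℕ} (hm : 2 ≤ m) (h0 : TInfinite m) (h1 : TInfinite (m + 1))
    {ν : ℝ} (hν : Tendsto (fun x : ℕ => (x : ℝ) / (iota m x : ℝ)) atTop (nhds ν)) :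
    Tendsto (fun K => (blockCount (m + 1) K : ℝ) / (m + 1) ^ K) atTop (nhds ν) := by
  have hinf := infinite_curl_rulerWord_le (by omega) (by omega : m ≤ m + 1) h1 h0
  have hcount : ∀ K, Nat.count (fun x => curl (rulerWord (m + 1) x) ≤ m) ((m + 2) ^ K) =
      blockCount (m + 1) K + 1 := fun K => count_pow_eq_blockCount (n := m + 1) (by omega) K
  have hL := self_le_blockCount (by omega : 3 ≤ m + 1) h1
  have hLt : Tendsto (fun K => blockCount (m + 1) K) atTop atTop := tendsto_atTop_mono hL tendsto_id
  have ht1 : Tendsto (fun K => ((1 : ℝ) / (m + 1)) ^ K) atTop (nhds 0) :=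
    tendsto_pow_atTop_nhds_zero_of_lt_one (by positivity)
      (by rw [div_lt_one (by positivity)]; norm_cast; omega)
  have hlo := (hν.comp ((tendsto_add_atTop_nat 2).comp hLt)).sub (ht1.const_mul 2)
  have hhi := (hν.comp ((tendsto_add_atTop_nat 1).comp hLt))
  rw [mul_zero, sub_zero] at hlo
  refine tendsto_of_tendsto_of_tendsto_of_le_of_le' hlo hhi ?_ ?_
  · refine Eventually.of_forall fun K => ?_
    have hnth : (m + 2) ^ K ≤ rulerNth (m + 1) m (blockCount (m + 1) K + 1) :=
      (Nat.count_le_iff_le_nth hinf).1 (hcount K).le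
    have hi := (pow_le_iota_succ_iff hm h0 h1 _ _).2 hnth
    simp only [Function.comp]
    have hpos : (0 : ℝ) < (m + 1 : ℝ) ^ K := by positivity
    have hi' : (m + 1 : ℝ) ^ K ≤ (iota m (blockCount (m + 1) K + 1 + 1) : ℝ) := by exact_mod_cast hi
    have : ((blockCount (m + 1) K + 2 : ℕ) : ℝ) / (iota m (blockCount (m + 1) K + 2) : ℝ) ≤
        ((blockCount (m + 1) K + 2 : ℕ) : ℝ) / (m + 1 : ℝ) ^ K :=
      div_le_div_of_nonneg_left (by positivity) hpos hi'
    rw [div_pow, one_pow]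
    push_cast at this ⊢
    calc _ ≤ ((blockCount (m + 1) K : ℝ) + 2) / (m + 1 : ℝ) ^ K - 2 * (1 / (m + 1 : ℝ) ^ K) := by
          linarith
      _ = _ := by ring
  · filter_upwards [eventually_ge_atTop 1] with K hK
    simp only [Function.comp]
    have h1L := hL K
    have hnth : rulerNth (m + 1) m (blockCount (m + 1) K) < (m + 2) ^ K :=
      Nat.nth_lt_of_lt_count (n := (m + 2) ^ K) (p := fun x => curl (rulerWord (m + 1) x) ≤ m)
        (by rw [hcount]; omega)
    have hge : blockCount (m + 1) K ≤ rulerNth (m + 1) m (blockCount (m + 1) K) :=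
      (Nat.nth_strictMono hinf).le_apply
    have hi1 : iota m (blockCount (m + 1) K + 1) < (m + 1) ^ K := by
      by_contra! h
      exact absurd ((pow_le_iota_succ_iff hm h0 h1 _ _).1 h) (by omega)
    have hi2 : 1 ≤ iota m (blockCount (m + 1) K + 1) := by
      simpa using (pow_le_iota_succ_iff hm h0 h1 _ 0).2 (by simp; omega)
    have hi1' : (iota m (blockCount (m + 1) K + 1) : ℝ) ≤ (m + 1 : ℝ) ^ K := by
      exact_mod_cast hi1.le
    have hi2' : (0 : ℝ) < iota m (blockCount (m + 1) K + 1) := by exact_mod_cast hi2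
    calc (blockCount (m + 1) K : ℝ) / (m + 1) ^ K
        ≤ ((blockCount (m + 1) K + 1 : ℕ) : ℝ) / (m + 1) ^ K := by
          gcongr; linarith
      _ ≤ _ := div_le_div_of_nonneg_left (by positivity) hi2' hi1'

theorem blockCount_div_pow_eq_sum {m : ℕ} (hm : 2 ≤ m) (h1 : TInfinite (m + 1)) (K : ℕ) :
    (blockCount (m + 1) K : ℝ) / (m + 1) ^ K =
      ∑ v ∈ Finset.range K, if curl (Tstr (m + 1) (v + 1)) ≤ m then (m : ℝ) / (m + 1) ^ (v + 1)
        else 0 := by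
  induction K with
  | zero => simp [blockCount_zero]
  | succ K ih =>
    rw [Finset.sum_range_succ, ← ih, blockCount_succ (by omega) h1, Nat.add_sub_cancel]
    have : (m + 1 : ℝ) ≠ 0 := by positivity
    split_ifs
    · push_cast; field_simp; ring
    · push_cast; field_simp; ring

/-! ### The block recursion for the series -/

/-- The number of `y < x` for which the prefix preceding the `(y+1)`-st letter `m + 2` has curling
number at most `m + 1`. -/
noncomputable def innerCount (m x : ℕ) : ℕ :=
  Nat.count (fun y => curl (rulerWord (m + 2) y) ≤ m + 1) x

/-- Partial sums of the series `∑ u ^ v` over the `v` with `curl (Tstr (m + 1) (v + 1)) ≤ m`,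
indexed by positions in `A^(m+2)`. -/
noncomputable def innerSum (m : ℕ) (u : ℝ) (N : ℕ) : ℝ :=
  ∑ x ∈ Finset.range N, if curl (rulerWord (m + 2) x) ≤ m then u ^ innerCount m x else 0

theorem sum_range_innerCount {m : ℕ} (h1 : TInfinite (m + 1)) (h2 : TInfinite (m + 2))
    (u : ℝ) (N : ℕ) :
    (∑ v ∈ Finset.range (innerCount m N), if curl (Tstr (m + 1) (v + 1)) ≤ m then u ^ v else 0) =
      innerSum m u N := by
  induction N with
  | zero => simp [innerCount, innerSum]
  | succ N ih =>
    rw [innerSum, Finset.sum_range_succ, ← innerSum, ← ih, innerCount, Nat.count_succ, ← innerCount]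
    by_cases hN : curl (rulerWord (m + 2) N) ≤ m + 1
    · rw [if_pos hN, Finset.sum_range_succ, Tstr_eq_rulerWord (by omega) h1 h2, rulerNth, innerCount,
        Nat.nth_count (p := fun y => curl (rulerWord (m + 2) y) ≤ m + 1) hN]
    · rw [if_neg hN, if_neg (by omega), add_zero, add_zero]

/-- Indicator of the blocks whose leading position has curling number at most `c`. -/
noncomputable def blockInd (n c k : ℕ) : ℕ := if curl (Tstr n (k + 1)) ≤ c then 1 else 0

theorem innerSum_one {m : ℕ} (hm : 1 ≤ m) (u : ℝ) : innerSum m u 1 = 1 := by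
  simp [innerSum, innerCount, rulerWord_zero, curl_nil, hm]

theorem innerCount_block_add {m k j y : ℕ} (hm : 2 ≤ m) (h2 : TInfinite (m + 2)) (hj0 : 0 < j)
    (hj : j ≤ m + 1) (hy0 : 0 < y) (hy : y ≤ (m + 3) ^ k) :
    innerCount m (j * (m + 3) ^ k + y) =
      j * (blockCount (m + 2) k + blockInd (m + 2) (m + 1) k) + innerCount m y := by
  have e1 := count_block_add (n := m + 2) (by omega) h2 hj0 (by omega) hy0 hy
  have e2 := count_mul_pow (n := m + 2) (k := k) (by omega) h2 hj0 (by omega)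
  simp only [innerCount, blockInd]
  simp only [show m + 2 - 1 = m + 1 by omega,
    show m + 2 + 1 = m + 3 by omega] at e1 e2
  omega

theorem innerSum_block_add {m k j y : ℕ} (hm : 2 ≤ m) (h2 : TInfinite (m + 2)) (u : ℝ)
    (hj0 : 0 < j) (hj : j ≤ m + 2) (hy0 : 0 < y) (hy : y ≤ (m + 3) ^ k) :
    innerSum m u (j * (m + 3) ^ k + y) = innerSum m u (j * (m + 3) ^ k) +
      if j ≤ m then (blockInd (m + 2) m k + (innerSum m u y - 1)) *
        (u ^ (blockCount (m + 2) k + blockInd (m + 2) (m + 1) k)) ^ j else 0 := by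
  induction y, hy0 using Nat.le_induction with
  | base =>
    have hb := curl_rulerWord_block_le_iff (n := m + 2) (k := k) (c := m) (by omega) h2 hm hj0 hj
    rw [Nat.succ_eq_add_one, zero_add, innerSum, Finset.sum_range_succ, ← innerSum,
      innerSum_one (by omega)]
    congr 1
    simp only [show m + 3 = m + 2 + 1 by omega]
    by_cases hjm : j ≤ m
    · simp only [hb, hjm, true_and, if_true, blockInd]
      by_cases hg : curl (Tstr (m + 2) (k + 1)) ≤ m
      · have e2 := count_mul_pow (n := m + 2) (k := k) (by omega) h2 hj0 (by omega)
        simp only [show m + 2 - 1 = m + 1 by omega, if_pos (hg.trans (Nat.le_succ m))] at e2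
        simp only [hg, if_pos (hg.trans (Nat.le_succ m)), if_true, innerCount]
        rw [← pow_mul, mul_comm _ j, Nat.add_right_cancel e2]
        simp
      · simp [hg]
    · simp [hb, hjm]
  | succ y hy0 ih =>
    have hb := curl_rulerWord_block_add_le_iff (n := m + 2) (k := k) (c := m) (by omega) h2 hm hj
      hy0 (show y < (m + 2 + 1) ^ k from hy)
    simp only [show m + 2 + 1 = m + 3 by omega] at hb
    rw [← add_assoc, innerSum, Finset.sum_range_succ, ← innerSum, ih (by omega), add_assoc]
    congr 1
    rw [innerSum, innerSum, Finset.sum_range_succ, ← innerSum]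
    by_cases hjm : j ≤ m
    · simp only [hb, hjm, true_and, if_true]
      rw [innerCount_block_add hm h2 hj0 (by omega) hy0 (by omega)]
      split_ifs
      · rw [pow_add _ (j * _), mul_comm j, pow_mul]; ring
      · ring
    · simp [hb, hjm]

theorem innerSum_mul_pow {m k j : ℕ} (hm : 2 ≤ m) (h2 : TInfinite (m + 2)) (u : ℝ)
    (hj : j ≤ m + 2) :
    innerSum m u ((j + 1) * (m + 3) ^ k) = innerSum m u ((m + 3) ^ k) +
      ∑ i ∈ Finset.range j, if i + 1 ≤ m then
        (blockInd (m + 2) m k + (innerSum m u ((m + 3) ^ k) - 1)) *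
        (u ^ (blockCount (m + 2) k + blockInd (m + 2) (m + 1) k)) ^ (i + 1) else 0 := by
  induction j with
  | zero => simp
  | succ j ih =>
    rw [add_mul, one_mul, innerSum_block_add hm h2 u (by omega) (by omega) (by positivity) le_rfl,
      ih (by omega), Finset.sum_range_succ, add_assoc]

theorem innerSum_pow_succ {m k : ℕ} (hm : 2 ≤ m) (h2 : TInfinite (m + 2)) (u : ℝ) :
    innerSum m u ((m + 3) ^ (k + 1)) = innerSum m u ((m + 3) ^ k) +
      (blockInd (m + 2) m k + (innerSum m u ((m + 3) ^ k) - 1)) * ∑ i ∈ Finset.range m,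
        (u ^ (blockCount (m + 2) k + blockInd (m + 2) (m + 1) k)) ^ (i + 1) := by
  have := innerSum_mul_pow (k := k) hm h2 u le_rfl
  rw [pow_succ', show (m + 3) * (m + 3) ^ k = (m + 2 + 1) * (m + 3) ^ k from rfl, this, Finset.sum_range_succ, Finset.sum_range_succ,
    if_neg (by omega), if_neg (by omega), add_zero, add_zero, Finset.mul_sum]
  congr 1
  refine Finset.sum_congr rfl fun i hi => ?_
  rw [if_pos (Nat.succ_le_of_lt (Finset.mem_range.1 hi))]

theorem tendsto_innerSum {m : ℕ} (hm : 2 ≤ m) (h0 : TInfinite m) (h1 : TInfinite (m + 1))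
    (h2 : TInfinite (m + 2)) {ν : ℝ}
    (hν : Tendsto (fun x : ℕ => (x : ℝ) / (iota m x : ℝ)) atTop (nhds ν)) :
    Tendsto (fun k => (m : ℝ) / (m + 1) * innerSum m (1 / (m + 1)) ((m + 3) ^ k)) atTop
      (nhds ν) := by
  have hcount : ∀ k, innerCount m ((m + 3) ^ k) = blockCount (m + 2) k + 1 := fun k =>
    count_pow_eq_blockCount (n := m + 2) (by omega) k
  have ht : Tendsto (fun k => innerCount m ((m + 3) ^ k)) atTop atTop :=
    tendsto_atTop_mono (fun k => by
      have := self_le_blockCount (by omega : 3 ≤ m + 2) h2 k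
      rw [hcount]; exact this.trans (Nat.le_succ _)) tendsto_id
  refine ((tendsto_blockCount_div hm h0 h1 hν).comp ht).congr fun k => ?_
  rw [Function.comp, blockCount_div_pow_eq_sum hm h1, ← sum_range_innerCount h1 h2, Finset.mul_sum]
  refine Finset.sum_congr rfl fun v _ => ?_
  split_ifs
  · rw [pow_succ, div_pow, one_pow]; field_simp
  · simp

/-! ### Runs of trivial blocks -/

theorem Tstr_succ_count {n x : ℕ} (hn : 1 ≤ n) (h0 : TInfinite n) (h1 : TInfinite (n + 1))
    (hx : curl (rulerWord (n + 1) x) ≤ n) :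
    Tstr n (Nat.count (fun y => curl (rulerWord (n + 1) y) ≤ n) x + 1) = rulerWord (n + 1) x := by
  rw [Tstr_eq_rulerWord hn h0 h1, rulerNth,
    Nat.nth_count (p := fun y => curl (rulerWord (n + 1) y) ≤ n) hx]

theorem frequently_blockInd_eq_one {n c : ℕ} (hc : 2 ≤ c) (hcn : c ≤ n) (h0 : TInfinite n)
    (h1 : TInfinite (n + 1)) : ∃ᶠ k in atTop, blockInd n c k = 1 := by
  rw [frequently_atTop]
  intro K
  have h2 : curl (rulerWord (n + 1) 1) ≤ c := by
    have := curl_rulerWord_block_le_iff (n := n + 1) (k := 0) (j := 1) (c := c) (by omega) h1 hc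
      one_pos (by omega)
    rw [pow_zero, one_mul] at this
    rw [this, zero_add, Tstr_one (by omega), curl_nil]
    omega
  have h3 : curl (rulerWord (n + 1) ((n + 2) ^ (K + 1) + 1)) ≤ c := by
    have := curl_rulerWord_block_add_le_iff (n := n + 1) (k := K + 1) (j := 1) (y := 1) (c := c)
      (by omega) h1 hc (by omega) one_pos (Nat.one_lt_pow (by omega) (by omega))
    rw [one_mul] at this
    exact this.2 ⟨by omega, h2⟩
  refine ⟨Nat.count (fun y => curl (rulerWord (n + 1) y) ≤ n) ((n + 2) ^ (K + 1) + 1), ?_, ?_⟩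
  · have e1 : Nat.count (fun y => curl (rulerWord (n + 1) y) ≤ n) ((n + 2) ^ (K + 1)) = _ :=
      count_pow_eq_blockCount (n := n + 1) (by omega) (K + 1)
    have e2 := self_le_blockCount (by omega : 3 ≤ n + 1) h1 (K + 1)
    have e3 := Nat.count_monotone (fun y => curl (rulerWord (n + 1) y) ≤ n)
      (Nat.le_succ ((n + 2) ^ (K + 1)))
    simp only [Nat.succ_eq_add_one] at e3
    omega
  · rw [blockInd, if_pos]
    rw [Tstr_succ_count (by omega) h0 h1 (h3.trans hcn)]
    exact h3

theorem exists_run_blockInd_eq_zero {n : ℕ} (hn : 3 ≤ n) (h0 : TInfinite n)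
    (h1 : TInfinite (n + 1)) (K : ℕ) :
    ∃ k ≥ K, ∀ i < K, blockInd n (n - 1) (k + i) = 0 := by
  set p : ℕ → Prop := fun y => curl (rulerWord (n + 1) y) ≤ n with hp
  have hinf : {y | p y}.Infinite := infinite_curl_rulerWord_le (by omega) (by omega) h1 h0
  have hpos : 0 < (n + 2) ^ K := by positivity
  have e1 : Nat.count p ((n + 2) ^ K) = blockCount (n + 1) K + 1 :=
    count_pow_eq_blockCount (n := n + 1) (by omega) K
  have e2 := self_le_blockCount (by omega : 3 ≤ n + 1) h1 K
  have e3 : Nat.count p (n * (n + 2) ^ K + (n + 2) ^ K) + 1 = _ :=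
    count_block_add (n := n + 1) (k := K) (j := n) (by omega) h1 (by omega) (by omega) hpos le_rfl
  have e3' : Nat.count p (n * (n + 2) ^ K) + Nat.count p ((n + 2) ^ K) ≤
    Nat.count p (n * (n + 2) ^ K + (n + 2) ^ K) + 1 := e3 ▸ Nat.le_add_right _ _
  have e4 : Nat.count p ((n + 2) ^ K) ≤ Nat.count p (n * (n + 2) ^ K) :=
    Nat.count_monotone p (Nat.le_mul_of_pos_left _ (by omega))
  refine ⟨Nat.count p (n * (n + 2) ^ K), by omega, fun i hi => ?_⟩
  have hlo : n * (n + 2) ^ K ≤ rulerNth (n + 1) n (Nat.count p (n * (n + 2) ^ K) + i) :=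
    (Nat.count_le_iff_le_nth hinf).1 (Nat.le_add_right _ _)
  have hhi : rulerNth (n + 1) n (Nat.count p (n * (n + 2) ^ K) + i) <
      n * (n + 2) ^ K + (n + 2) ^ K := Nat.nth_lt_of_lt_count (p := p) (by omega)
  rw [blockInd, if_neg]
  rw [Tstr_eq_rulerWord (by omega) h0 h1]
  obtain ⟨y, hy⟩ := Nat.exists_eq_add_of_le hlo
  rw [hy]
  have hy' : y < (n + 2) ^ K := by omega
  rcases Nat.eq_zero_or_pos y with rfl | hy0
  · rw [add_zero, show n + 2 = n + 1 + 1 by omega,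
      curl_rulerWord_block_le_iff (by omega) h1 (by omega) (by omega) (by omega)]; omega
  · rw [show n + 2 = n + 1 + 1 by omega,
      curl_rulerWord_block_add_le_iff (by omega) h1 (by omega) (by omega) hy0 hy']; omega

theorem exists_exact_run {ε : ℕ → ℕ} (hε : ∀ k, ε k ≤ 1) (h1 : ∃ᶠ k in atTop, ε k = 1)
    (h0 : ∀ K, ∃ k ≥ K, ∀ i < K, ε (k + i) = 0) (r K : ℕ) :
    ∃ k ≥ K, (∀ i < r, ε (k + i) = 0) ∧ ε (k + r) = 1 := by
  obtain ⟨k, hk, hrun⟩ := h0 (K + r)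
  have hex : ∃ l, ε (k + l) = 1 := by
    obtain ⟨l, hl, he⟩ := frequently_atTop.1 h1 k
    exact ⟨l - k, by rwa [Nat.add_sub_cancel' hl]⟩
  have hfind : K + r ≤ Nat.find hex := by
    by_contra! hlt
    have := Nat.find_spec hex
    rw [hrun _ hlt] at this
    omega
  refine ⟨k + (Nat.find hex - r), by omega, fun i hi => ?_, ?_⟩
  · have h2 := Nat.find_min hex (m := Nat.find hex - r + i) (by omega)
    have h3 := hε (k + (Nat.find hex - r + i))
    rw [add_assoc]
    omega
  · rw [add_assoc, Nat.sub_add_cancel (by omega)]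
    exact Nat.find_spec hex

/-- A sequence `v` built up by the block recursion with exponents `L`, where `ε` and `g` indicate
which blocks contribute an additional position. -/
structure BlockRec (m : ℕ) (L ε g : ℕ → ℕ) (v : ℕ → ℝ) : Prop where
  g_le (k : ℕ) : g k ≤ ε k
  ε_le (k : ℕ) : ε k ≤ 1
  ε_zero : ε 0 = 1
  g_zero : g 0 = 1
  L_zero : L 0 = 0
  v_zero : v 0 = 0
  L_succ (k : ℕ) : L (k + 1) = (m + 2) * L k + (m + 1) * ε k
  v_succ (k : ℕ) : v (k + 1) = v k +
    (g k + v k) * ∑ i ∈ Finset.range m, ((1 / (m + 1) : ℝ) ^ (L k + ε k)) ^ (i + 1)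
  frequently_g : ∃ᶠ k in atTop, g k = 1
  exists_run (r K : ℕ) : ∃ k ≥ K, (∀ i < r, ε (k + i) = 0) ∧ ε (k + r) = 1

theorem exists_blockRec (hSH : StandingHyp) {m : ℕ} (hm : 2 ≤ m) {ν : ℝ}
    (hν : Tendsto (fun x : ℕ => (x : ℝ) / (iota m x : ℝ)) atTop (nhds ν)) :
    ∃ L ε g v, BlockRec m L ε g v ∧ ∃ α, Tendsto v atTop (nhds α) ∧
      ν = (m : ℝ) / (m + 1) * (1 + α) := by
  have hT : ∀ n, 1 ≤ n → TInfinite n := fun n hn => (hSH n hn).2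
  have h2 := hT (m + 2) (by omega)
  have h3 := hT (m + 3) (by omega)
  have hle : ∀ k, blockInd (m + 2) m k ≤ blockInd (m + 2) (m + 1) k := fun k => by
    simp only [blockInd]; split_ifs <;> omega
  have hle1 : ∀ k, blockInd (m + 2) (m + 1) k ≤ 1 := fun k => by
    simp only [blockInd]; split_ifs <;> omega
  have hg := frequently_blockInd_eq_one (n := m + 2) hm (by omega) h2 h3
  refine ⟨blockCount (m + 2), blockInd (m + 2) (m + 1), blockInd (m + 2) m,
    fun k => innerSum m (1 / (m + 1)) ((m + 3) ^ k) - 1, ?_, ν * ((m + 1) / m) - 1, ?_, ?_⟩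
  · refine ⟨hle, hle1, ?_, ?_, blockCount_zero _, ?_, ?_, ?_, hg, ?_⟩
    · rw [blockInd, zero_add, Tstr_one (by omega), curl_nil, if_pos (by omega)]
    · rw [blockInd, zero_add, Tstr_one (by omega), curl_nil, if_pos (by omega)]
    · simp [innerSum_one (show 1 ≤ m by omega)]
    · intro k
      rw [blockCount_succ (by omega) h2, blockInd]
      rfl
    · intro k
      simp only [innerSum_pow_succ hm h2]
      ring
    · refine exists_exact_run hle1 (hg.mono fun k hk => ?_) fun K => ?_
      · have := hle k
        have := hle1 k
        omega
      · exact exists_run_blockInd_eq_zero (n := m + 2) (by omega) h2 h3 K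
  · have hm0 : (m : ℝ) ≠ 0 := by positivity
    have := (tendsto_innerSum hm (hT m (by omega)) (hT (m + 1) (by omega)) h2 hν).mul_const
      (((m : ℝ) + 1) / m)
    refine (this.sub_const 1).congr fun k => ?_
    field_simp
  · have hm0 : (m : ℝ) ≠ 0 := by positivity
    field_simp
    ring

/-! ### Bounds for the block recursion -/

namespace BlockRec

variable {m : ℕ} {L ε g : ℕ → ℕ} {v : ℕ → ℝ}

/-- The scale `(m + 1) ^ (- L k)` of the `k`-th stage of the recursion. -/
noncomputable def scale (m : ℕ) (L : ℕ → ℕ) (k : ℕ) : ℝ := (1 / (m + 1) : ℝ) ^ L k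

theorem scale_pos (m : ℕ) (L : ℕ → ℕ) (k : ℕ) : 0 < scale m L k := by
  rw [scale]; positivity

theorem scale_le_one (m : ℕ) (L : ℕ → ℕ) (k : ℕ) : scale m L k ≤ 1 :=
  pow_le_one₀ (by positivity) (by rw [div_le_one (by positivity)]; norm_cast; omega)

theorem scale_succ (h : BlockRec m L ε g v) (k : ℕ) : scale m L (k + 1) =
    scale m L k * ((1 / (m + 1) : ℝ) ^ (L k + ε k)) ^ (m + 1) := by
  rw [scale, scale, h.L_succ, ← pow_mul, ← pow_add]
  congr 1
  ring

theorem scale_eq (h : BlockRec m L ε g v) (k : ℕ) :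
    (ε k = 0 ∧ g k = 0 ∧ (1 / (m + 1) : ℝ) ^ (L k + ε k) = scale m L k) ∨
    (ε k = 1 ∧ g k ≤ 1 ∧ scale m L k = (m + 1) * (1 / (m + 1) : ℝ) ^ (L k + ε k)) := by
  have h1 := h.g_le k
  have h2 := h.ε_le k
  rcases Nat.eq_zero_or_pos (ε k) with h3 | h3
  · left
    exact ⟨h3, by omega, by rw [h3, scale, add_zero]⟩
  · right
    have h4 : ε k = 1 := by omega
    refine ⟨h4, by omega, ?_⟩
    rw [h4, scale, pow_succ]
    field_simp

theorem nonneg (h : BlockRec m L ε g v) (k : ℕ) : 0 ≤ v k := by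
  induction k with
  | zero => exact h.v_zero.ge
  | succ k ih => rw [h.v_succ]; positivity

theorem monotone (h : BlockRec m L ε g v) : Monotone v :=
  monotone_nat_of_le_succ fun k => by
    rw [h.v_succ]
    have := h.nonneg k
    exact le_add_of_nonneg_right (by positivity)

theorem increment_le (h : BlockRec m L ε g v) (hm : 1 ≤ m) {k : ℕ}
    (hk : v k + scale m L k / m ≤ 1 / m) :
    v (k + 1) + scale m L (k + 1) / m ≤ v k + scale m L k / m := by
  have hm0 : (0 : ℝ) < m := by exact_mod_cast hm
  have hX := scale_pos m L k
  have hX1 := scale_le_one m L k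
  have hv := h.nonneg k
  rw [h.v_succ, h.scale_succ]
  have hvm : v k * m ≤ 1 - scale m L k := by
    rw [add_div' _ _ _ hm0.ne', div_le_div_iff_of_pos_right hm0] at hk
    linarith
  have hx0 : (0 : ℝ) < (1 / (m + 1) : ℝ) ^ (L k + ε k) := by positivity
  have hx1 : (1 / (m + 1) : ℝ) ^ (L k + ε k) ≤ 1 :=
    pow_le_one₀ (by positivity) (by rw [div_le_one (by positivity)]; norm_cast; omega)
  have heq := h.scale_eq k
  generalize (1 / (m + 1) : ℝ) ^ (L k + ε k) = x at *
  generalize scale m L k = X at *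
  have hG : ∑ i ∈ Finset.range m, x ^ (i + 1) = x * ∑ i ∈ Finset.range m, x ^ i := by
    rw [Finset.mul_sum]; exact Finset.sum_congr rfl fun i _ => by ring
  have hgeom := mul_neg_geom_sum x m
  have hS : 0 ≤ ∑ i ∈ Finset.range m, x ^ i := by positivity
  rw [hG]
  generalize ∑ i ∈ Finset.range m, x ^ i = S at *
  have hxm : 0 ≤ x ^ m := by positivity
  have hxx : x ^ (m + 1) ≤ x ^ m := pow_le_pow_of_le_one hx0.le hx1 (Nat.le_succ m)
  have key : m * ((g k + v k) * x) ≤ X * (1 - x) := by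
    rcases heq with ⟨-, h2, h3⟩ | ⟨-, h2, h3⟩
    · rw [h2, h3]; push_cast; nlinarith
    · have : (g k : ℝ) ≤ 1 := by exact_mod_cast h2
      rw [h3] at hvm ⊢
      nlinarith [mul_nonneg hm0.le hx0.le]
  have key2 : m * ((g k + v k) * x) * S ≤ X * (1 - x ^ m) := by
    calc _ ≤ X * (1 - x) * S := by gcongr
      _ = _ := by rw [mul_assoc, hgeom]
  rw [← sub_nonneg]
  have : v k + X / m - (v k + (g k + v k) * (x * S) + X * x ^ (m + 1) / m) =
    (X * (1 - x ^ (m + 1)) - m * ((g k + v k) * x) * S) / m := by field_simp; ring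
  rw [this]
  apply div_nonneg _ hm0.le
  nlinarith

theorem add_scale_le (h : BlockRec m L ε g v) (hm : 1 ≤ m) (k : ℕ) :
    v k + scale m L k / m ≤ 1 / m := by
  induction k with
  | zero => simp [h.v_zero, scale, h.L_zero]
  | succ k ih => exact (h.increment_le hm ih).trans ih

theorem antitone (h : BlockRec m L ε g v) (hm : 1 ≤ m) :
    Antitone fun k => v k + scale m L k / m :=
  antitone_nat_of_succ_le fun k => h.increment_le hm (h.add_scale_le hm k)

theorem le_limit (h : BlockRec m L ε g v) {α : ℝ} (hα : Tendsto v atTop (nhds α)) (k : ℕ) :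
    v k ≤ α := h.monotone.ge_of_tendsto hα k

theorem limit_le (h : BlockRec m L ε g v) (hm : 1 ≤ m) {α : ℝ} (hα : Tendsto v atTop (nhds α))
    (k : ℕ) : α ≤ v k + scale m L k / m :=
  le_of_tendsto hα (by
    filter_upwards [eventually_ge_atTop k] with j hj
    refine le_trans ?_ (h.antitone hm hj)
    have := scale_pos m L j
    exact le_add_of_nonneg_right (by positivity))

theorem limit_pos (h : BlockRec m L ε g v) (hm : 1 ≤ m) {α : ℝ} (hα : Tendsto v atTop (nhds α)) :
    0 < α := by
  refine lt_of_lt_of_le ?_ (h.le_limit hα 1)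
  rw [h.v_succ, h.v_zero, h.g_zero]
  have : 0 < ∑ i ∈ Finset.range m, ((1 / (m + 1) : ℝ) ^ (L 0 + ε 0)) ^ (i + 1) :=
    Finset.sum_pos (fun i _ => by positivity) (by simp; omega)
  simpa using this

theorem limit_lt (h : BlockRec m L ε g v) (hm : 1 ≤ m) {α : ℝ} (hα : Tendsto v atTop (nhds α)) :
    α < 1 / m := by
  refine lt_of_le_of_lt (h.limit_le hm hα 1) ?_
  have hm0 : (0 : ℝ) < m := by exact_mod_cast hm
  rw [h.scale_succ, h.v_succ, h.v_zero, h.g_zero, h.L_zero, h.ε_zero, scale, h.L_zero]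
  have hG : ∑ i ∈ Finset.range m, ((1 / (m + 1) : ℝ) ^ (0 + 1)) ^ (i + 1) =
      (1 - (1 / (m + 1) : ℝ) ^ m) / m := by
    have hgeom := mul_neg_geom_sum (1 / (m + 1) : ℝ) m
    have hu : (1 - 1 / (m + 1) : ℝ) = m * (1 / (m + 1)) := by field_simp; ring
    rw [← hgeom, hu, Finset.mul_sum, Finset.sum_div]
    refine Finset.sum_congr rfl fun i _ => ?_
    rw [zero_add, pow_one, pow_succ]
    field_simp
  rw [hG]
  simp only [Nat.cast_one, add_zero, zero_add, pow_zero, one_mul, pow_succ]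
  rw [← add_div, div_lt_div_iff_of_pos_right hm0]
  have h1 : (1 / (m + 1) : ℝ) < 1 := by rw [div_lt_one (by positivity)]; linarith
  have h2 : 0 < (1 / (m + 1) : ℝ) ^ m := by positivity
  nlinarith

theorem self_le_L (h : BlockRec m L ε g v) (k : ℕ) : k ≤ L k := by
  induction k with
  | zero => simp
  | succ k ih =>
    rw [h.L_succ]
    rcases Nat.eq_zero_or_pos k with rfl | hk
    · rw [h.ε_zero]; omega
    · nlinarith [Nat.zero_le ((m + 1) * ε k), Nat.zero_le (m * L k)]

theorem tendsto_scale (h : BlockRec m L ε g v) (hm : 1 ≤ m) :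
    Tendsto (scale m L) atTop (nhds 0) :=
  (tendsto_pow_atTop_nhds_zero_of_lt_one (by positivity)
    (by rw [div_lt_one (by positivity)]; norm_cast; omega)).comp
    (tendsto_atTop_mono h.self_le_L tendsto_id)

theorem exists_int_eq (h : BlockRec m L ε g v) (k : ℕ) :
    ∃ a : ℤ, v k * (m + 1) ^ L k = a := by
  induction k with
  | zero => exact ⟨0, by simp [h.v_zero]⟩
  | succ k ih =>
    obtain ⟨a, ha⟩ := ih
    refine ⟨a * ((m + 1) ^ (L k + ε k)) ^ (m + 1) + (g k * (m + 1) ^ L k + a) *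
      ∑ i ∈ Finset.range m, (((m + 1) ^ (L k + ε k)) ^ (m - i)), ?_⟩
    push_cast
    rw [← ha, h.v_succ, h.L_succ, show (m + 2) * L k + (m + 1) * ε k =
      L k + (L k + ε k) * (m + 1) by ring, pow_add (m + 1 : ℝ) (L k) (_ * _),
      pow_mul (m + 1 : ℝ) (L k + ε k)]
    have : ∑ i ∈ Finset.range m, ((m + 1 : ℝ) ^ (L k + ε k)) ^ (m - i) =
        ((m + 1 : ℝ) ^ (L k + ε k)) ^ (m + 1) *
        ∑ i ∈ Finset.range m, ((1 / (m + 1) : ℝ) ^ (L k + ε k)) ^ (i + 1) := by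
      rw [Finset.mul_sum]
      refine Finset.sum_congr rfl fun i hi => ?_
      have hi' := Finset.mem_range.1 hi
      rw [show m + 1 = (m - i) + (i + 1) by omega, pow_add _ (m - i) (i + 1), div_pow, one_pow,
        div_pow, one_pow]
      field_simp
    rw [this]
    ring

/-! ### Good rational approximations -/

theorem abs_sub_le (h : BlockRec m L ε g v) (hm : 1 ≤ m) {α : ℝ}
    (hα : Tendsto v atTop (nhds α)) {k : ℕ} (hk : g k = 1) :
    |(m : ℝ) / (m + 1) * (1 + α) - m * (m + 1) ^ L k * (1 + v k) / ((m + 1) ^ (L k + 1) - 1)| ≤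
      ((1 / (m + 1) : ℝ) ^ (L k + 1)) ^ (m + 1) := by
  have hm0 : (0 : ℝ) < m := by exact_mod_cast hm
  have hεk : ε k = 1 := by have := h.g_le k; have := h.ε_le k; omega
  have hv1 := h.v_succ k
  have hs := h.scale_succ k
  have hlo := h.le_limit hα (k + 1)
  have hhi := h.limit_le hm hα (k + 1)
  have hb := h.add_scale_le hm k
  have hv := h.nonneg k
  have hX : scale m L k = (m + 1) * (1 / (m + 1) : ℝ) ^ (L k + 1) := by
    rw [scale, pow_succ]; field_simp
  have hx1 : (1 / (m + 1) : ℝ) ^ (L k + 1) < 1 :=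
    pow_lt_one₀ (by positivity) (by rw [div_lt_one (by positivity)]; linarith) (by omega)
  have hfrac : (m : ℝ) * (m + 1) ^ L k * (1 + v k) / ((m + 1) ^ (L k + 1) - 1) =
      m / (m + 1) * ((1 + v k) / (1 - (1 / (m + 1) : ℝ) ^ (L k + 1))) := by
    have hp : (1 : ℝ) < (m + 1) ^ (L k + 1) := one_lt_pow₀ (by linarith) (by omega)
    have hne : (m + 1 : ℝ) ^ (L k + 1) - 1 ≠ 0 := by linarith
    rw [div_pow, one_pow, one_sub_div (by positivity)]
    field_simp
    ring
  rw [hfrac]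
  have hx0 : 0 < (1 / (m + 1) : ℝ) ^ (L k + 1) := by positivity
  rw [hεk, hk] at hv1
  rw [hεk, hX] at hs
  rw [hX] at hb
  generalize (1 / (m + 1) : ℝ) ^ (L k + 1) = x at *
  have hgeom := mul_neg_geom_sum x m
  have hG : ∑ i ∈ Finset.range m, x ^ (i + 1) = x * ∑ i ∈ Finset.range m, x ^ i := by
    rw [Finset.mul_sum]; exact Finset.sum_congr rfl fun i _ => by ring
  rw [hG] at hv1
  have hx1' : 0 < 1 - x := by linarith
  have hv2 : 1 + v (k + 1) = (1 + v k) / (1 - x) - (1 + v k) * x ^ (m + 1) / (1 - x) := by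
    rw [← sub_div, eq_div_iff hx1'.ne', hv1]
    push_cast
    linear_combination (1 + v k) * x * hgeom
  have hmv : m * (1 + v k) ≤ (m + 1) * (1 - x) := by
    rw [add_div' _ _ _ hm0.ne', div_le_div_iff_of_pos_right hm0] at hb
    linarith
  have hxp : 0 < x ^ (m + 1) := by positivity
  have e1 : (m : ℝ) / (m + 1) * (1 + α) - m / (m + 1) * ((1 + v k) / (1 - x)) =
      m / (m + 1) * (α - v (k + 1)) - (m * (1 + v k)) / ((m + 1) * (1 - x)) * x ^ (m + 1) := by
    have : (1 + v k) / (1 - x) = 1 + v (k + 1) + (1 + v k) * x ^ (m + 1) / (1 - x) := by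
      rw [hv2]; ring
    rw [this]
    field_simp
    ring
  have e2 : m / (m + 1) * (α - v (k + 1)) ≤ x ^ (m + 1) := by
    have : α - v (k + 1) ≤ (m + 1) * x * x ^ (m + 1) / m := by rw [← hs]; linarith
    calc m / (m + 1) * (α - v (k + 1)) ≤ m / (m + 1) * ((m + 1) * x * x ^ (m + 1) / m) := by gcongr
      _ = x * x ^ (m + 1) := by field_simp
      _ ≤ _ := mul_le_of_le_one_left hxp.le hx1.le
  have e3 : 0 ≤ m / (m + 1) * (α - v (k + 1)) := mul_nonneg (by positivity) (by linarith)
  have e4 : (m * (1 + v k)) / ((m + 1) * (1 - x)) ≤ 1 := (div_le_one (by positivity)).2 hmv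
  have e5 : 0 ≤ (m * (1 + v k)) / ((m + 1) * (1 - x)) := by positivity
  rw [e1, abs_le]
  constructor <;> nlinarith

theorem infinite_approximations (h : BlockRec m L ε g v) (hm : 1 ≤ m) {α : ℝ}
    (hα : Tendsto v atTop (nhds α)) {ν : ℝ} (hν : ν = (m : ℝ) / (m + 1) * (1 + α))
    (htr : Transcendental ℚ ν) :
    {pq : ℤ × ℤ | 0 < pq.2 ∧ 0 < |ν - (pq.1 : ℝ) / (pq.2 : ℝ)| ∧
      |ν - (pq.1 : ℝ) / (pq.2 : ℝ)| < 1 / (pq.2 : ℝ) ^ (m + 1)}.Infinite := by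
  intro hfin
  obtain ⟨B, hB⟩ := (hfin.image Prod.snd).bddAbove
  obtain ⟨k, hkB, hk⟩ := frequently_atTop.1 h.frequently_g (B.toNat + 1)
  obtain ⟨a, ha⟩ := h.exists_int_eq k
  have hgrow : (B : ℤ) < (m + 1 : ℤ) ^ (L k + 1) - 1 := by
    have h1 : L k + 1 < (m + 1) ^ (L k + 1) := Nat.lt_pow_self (by omega)
    have h2 := h.self_le_L k
    have h3 : (L k + 1 : ℤ) < (m + 1 : ℤ) ^ (L k + 1) := by exact_mod_cast h1
    omega
  refine absurd (hB ⟨((m : ℤ) * ((m + 1) ^ L k + a), (m + 1 : ℤ) ^ (L k + 1) - 1), ?_, rfl⟩)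
    (not_le.2 hgrow)
  have hp : (1 : ℝ) < (m + 1) ^ (L k + 1) :=
    one_lt_pow₀ (by have : (0 : ℝ) < m := by exact_mod_cast hm
                    linarith) (by omega)
  have hq : (0 : ℝ) < (m + 1) ^ (L k + 1) - 1 := by linarith
  refine ⟨?_, ?_, ?_⟩
  · exact_mod_cast hq
  · rw [abs_pos, sub_ne_zero]
    intro he
    apply htr
    rw [he]
    have := isAlgebraic_algebraMap (R := ℚ) (A := ℝ)
      ((((m : ℤ) * ((m + 1) ^ L k + a) : ℤ) : ℚ) / (((m + 1 : ℤ) ^ (L k + 1) - 1 : ℤ) : ℚ))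
    simpa using this
  · have hle := h.abs_sub_le hm hα hk
    push_cast
    rw [← hν, show (m : ℝ) * (m + 1) ^ L k * (1 + v k) = m * ((m + 1) ^ L k + a) by
      rw [← ha]; ring] at hle
    refine hle.trans_lt ?_
    rw [div_pow, one_pow, div_pow, one_pow]
    exact one_div_lt_one_div_of_lt (by positivity) (pow_lt_pow_left₀ (by linarith) hq.le (by omega))

end BlockRec

/-! ### The lacunary product -/

/-- The indicator of the numbers all of whose base-`(m + 2)` digits are at most `m`. -/
noncomputable def smallDigits (m n : ℕ) : ℝ := if ∀ d ∈ Nat.digits (m + 2) n, d ≤ m then 1 else 0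

theorem smallDigits_nonneg (m n : ℕ) : 0 ≤ smallDigits m n := by
  rw [smallDigits]; split_ifs <;> norm_num

theorem smallDigits_le_one (m n : ℕ) : smallDigits m n ≤ 1 := by
  rw [smallDigits]; split_ifs <;> norm_num

theorem smallDigits_of_le {m n : ℕ} (hn : n ≤ m) : smallDigits m n = 1 := by
  rw [smallDigits, if_pos]
  rcases Nat.eq_zero_or_pos n with rfl | h
  · simp
  · rw [Nat.digits_of_lt _ _ h.ne' (by omega)]
    simpa using hn

theorem smallDigits_mul_add (m q : ℕ) {j : ℕ} (hj : j < m + 2) :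
    smallDigits m (q * (m + 2) + j) = smallDigits m q * if j ≤ m then 1 else 0 := by
  rcases Nat.eq_zero_or_pos (q + j) with h | h
  · obtain ⟨rfl, rfl⟩ : q = 0 ∧ j = 0 := by omega
    simp
  · have h1 : Nat.digits (m + 2) (q * (m + 2) + j) = j :: Nat.digits (m + 2) q := by
      rw [add_comm (q * (m + 2)), mul_comm q]
      exact Nat.digits_add _ (by omega) _ _ hj (by omega : j ≠ 0 ∨ q ≠ 0)
    rw [smallDigits, smallDigits, h1]
    simp only [List.forall_mem_cons]
    by_cases h2 : j ≤ m <;> simp [h2]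

/-- The product `∏ i, (1 + x ^ N ^ i + ⋯ + x ^ (m * N ^ i))` with `N = m + 2`, as a power series. -/
noncomputable def lacunary (m : ℕ) (x : ℝ) : ℝ := ∑' n, smallDigits m n * x ^ n

theorem summable_lacunary (m : ℕ) {x : ℝ} (h0 : 0 ≤ x) (h1 : x < 1) :
    Summable fun n => smallDigits m n * x ^ n :=
  (summable_geometric_of_lt_one h0 h1).of_nonneg_of_le
    (fun n => mul_nonneg (smallDigits_nonneg m n) (pow_nonneg h0 n))
    fun n => mul_le_of_le_one_left (pow_nonneg h0 n) (smallDigits_le_one m n)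

theorem analyticAt_lacunary (m : ℕ) : AnalyticAt ℝ (lacunary m) 0 := by
  have hr : (1 : ENNReal) ≤ (FormalMultilinearSeries.ofScalars ℝ (smallDigits m)).radius := by
    refine FormalMultilinearSeries.le_radius_of_bound _ (r := 1) 1 fun n => ?_
    rw [FormalMultilinearSeries.ofScalars_norm, Real.norm_of_nonneg (smallDigits_nonneg m n)]
    simpa using smallDigits_le_one m n
  have h := (FormalMultilinearSeries.ofScalars ℝ (smallDigits m)).hasFPowerSeriesOnBall
    (lt_of_lt_of_le zero_lt_one hr)
  have he : lacunary m = (FormalMultilinearSeries.ofScalars ℝ (smallDigits m)).sum := by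
    funext x
    simp [lacunary, FormalMultilinearSeries.sum, mul_comm]
  rw [he]
  exact h.analyticAt

theorem lacunary_le (m : ℕ) {x : ℝ} (h0 : 0 ≤ x) (h1 : x < 1) : lacunary m x ≤ 1 / (1 - x) := by
  rw [one_div, ← tsum_geometric_of_lt_one h0 h1]
  exact (summable_lacunary m h0 h1).tsum_le_tsum
    (fun n => mul_le_of_le_one_left (pow_nonneg h0 n) (smallDigits_le_one m n))
    (summable_geometric_of_lt_one h0 h1)

theorem le_lacunary {m : ℕ} (hm : 1 ≤ m) {x : ℝ} (h0 : 0 ≤ x) (h1 : x < 1) :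
    1 + x ≤ lacunary m x := by
  have h := (summable_lacunary m h0 h1).sum_le_tsum (Finset.range 2)
    fun n _ => mul_nonneg (smallDigits_nonneg m n) (pow_nonneg h0 n)
  simpa [lacunary, Finset.sum_range_succ, smallDigits_of_le hm, smallDigits_of_le (Nat.zero_le m)] using h

theorem lacunary_eq (m : ℕ) {x : ℝ} (h0 : 0 ≤ x) (h1 : x < 1) :
    lacunary m x = (∑ j ∈ Finset.range (m + 1), x ^ j) * lacunary m (x ^ (m + 2)) := by
  have hs := summable_lacunary m h0 h1
  have hs2 := ((Nat.divModEquiv (m + 2)).symm.summable_iff).mpr hs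
  rw [lacunary, ← (Nat.divModEquiv (m + 2)).symm.tsum_eq]
  refine hs2.tsum_prod.trans ?_
  rw [lacunary, ← tsum_mul_left]
  refine tsum_congr fun q => ?_
  rw [tsum_fintype, Finset.sum_mul]
  simp only [Function.comp_apply, Nat.divModEquiv_symm_apply]
  rw [Fin.sum_univ_eq_sum_range
    (fun j => smallDigits m (q * (m + 2) + j) * x ^ (q * (m + 2) + j)) (m + 2),
    Finset.sum_range_succ, smallDigits_mul_add m q (by omega), if_neg (by omega)]
  rw [mul_zero, zero_mul, add_zero]
  refine Finset.sum_congr rfl fun j hj => ?_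
  have hj' : j < m + 1 := Finset.mem_range.1 hj
  rw [smallDigits_mul_add m q (by omega), if_pos (by omega), pow_add, mul_comm q, pow_mul]
  ring

/-- A real function analytic at `0` and not locally zero is bounded below by a monomial. -/
theorem AnalyticAt.exists_pow_le_norm {f : ℝ → ℝ} (hf : AnalyticAt ℝ f 0)
    (h0 : ¬ ∀ᶠ x in nhds 0, f x = 0) :
    ∃ (o : ℕ) (c : ℝ), 0 < c ∧ ∀ᶠ x in nhds (0 : ℝ), c * |x| ^ o ≤ |f x| := by
  obtain ⟨o, G, hG, hG0, h⟩ := hf.exists_eventuallyEq_pow_smul_nonzero_iff.2 h0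
  refine ⟨o, |G 0| / 2, by positivity, ?_⟩
  have h1 : ∀ᶠ x in nhds (0 : ℝ), |G 0| / 2 < |G x| :=
    (hG.continuousAt.abs.tendsto).eventually (lt_mem_nhds (half_lt_self (abs_pos.2 hG0)))
  filter_upwards [h, h1] with x hx hx1
  rw [hx, sub_zero, smul_eq_mul, abs_mul, abs_pow, mul_comm]
  gcongr

/-! ### The auxiliary polynomial -/

open Polynomial in
/-- Linear algebra over `ℚ⟮α⟯` provides an integer polynomial of degree at most `D` in each variable,
homogenised in the second one by `g`, which vanishes to order `2 * D + 1` along `α`. -/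
theorem IsAlgebraic.exists_auxiliary {α : ℝ} (hα : IsAlgebraic ℚ α) :
    ∃ D : ℕ, ∀ g : ℤ[X], ∃ q : ℕ → ℕ → ℤ, (∃ i ≤ D, ∃ j ≤ D, q i j ≠ 0) ∧ ∃ h : ℝ[X], ∀ x : ℝ,
      ∑ i ∈ Finset.range (D + 1), ∑ j ∈ Finset.range (D + 1),
        (q i j : ℝ) * x ^ i * α ^ j * aeval x g ^ (D - j) = x ^ (2 * D + 1) * h.eval x := by
  set K := IntermediateField.adjoin ℚ {α} with hK
  have hfin : FiniteDimensional ℚ K :=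
    IntermediateField.adjoin.finiteDimensional hα.isIntegral
  set d := Module.finrank ℚ K with hd
  have hdpos : 0 < d := Module.finrank_pos
  refine ⟨2 * d, fun g => ?_⟩
  set D := 2 * d with hD
  let a : K := IntermediateField.AdjoinSimple.gen ℚ α
  let P : Fin (D + 1) × Fin (D + 1) → K[X] := fun p =>
    C (a ^ (p.2 : ℕ)) * X ^ (p.1 : ℕ) * (g.map (Int.castRingHom K)) ^ (D - (p.2 : ℕ))
  let φ : (Fin (D + 1) × Fin (D + 1) → ℚ) →ₗ[ℚ] (Fin (2 * D + 1) → K) :=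
    LinearMap.pi fun n => ((lcoeff K n).restrictScalars ℚ) ∘ₗ Fintype.linearCombination ℚ P
  have hker : LinearMap.ker φ ≠ ⊥ := by
    apply LinearMap.ker_ne_bot_of_finrank_lt
    rw [Module.finrank_pi_fintype, Module.finrank_fintype_fun_eq_card]
    simp only [Finset.sum_const, Finset.card_univ, Fintype.card_fin, Fintype.card_prod,
      smul_eq_mul, ← hd]
    nlinarith
  obtain ⟨c, hc, hc0⟩ := Submodule.exists_mem_ne_zero_of_ne_bot hker
  obtain ⟨b, hb⟩ := IsLocalization.exist_integer_multiples_of_finite (nonZeroDivisors ℤ) c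
  choose z hz using hb
  have hb0 : ((b : ℤ) : ℚ) ≠ 0 := by
    exact_mod_cast nonZeroDivisors.coe_ne_zero b
  have hz' : ∀ p, (z p : ℚ) = (b : ℤ) * c p := fun p => by
    have := hz p
    simpa using this
  have hdvd : X ^ (2 * D + 1) ∣ ∑ p, (z p : K[X]) * P p := by
    rw [X_pow_dvd_iff]
    intro n hn
    have h1 : (Fintype.linearCombination ℚ P c).coeff n = 0 := by
      have := congrFun (LinearMap.mem_ker.1 hc) ⟨n, hn⟩
      simpa [φ] using this
    have h2 : ∑ p, (z p : K[X]) * P p = ((b : ℤ) : ℚ) • Fintype.linearCombination ℚ P c := by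
      rw [Fintype.linearCombination_apply, Finset.smul_sum]
      refine Finset.sum_congr rfl fun p _ => ?_
      rw [smul_smul, ← hz', Int.cast_smul_eq_zsmul ℚ, zsmul_eq_mul]
    rw [h2, coeff_smul, h1, smul_zero]
  obtain ⟨h, hh⟩ := hdvd
  refine ⟨fun i j => if hij : i < D + 1 ∧ j < D + 1 then z (⟨i, hij.1⟩, ⟨j, hij.2⟩) else 0, ?_,
    h.map (algebraMap K ℝ), fun x => ?_⟩
  · obtain ⟨⟨i, j⟩, hij⟩ := Function.ne_iff.1 hc0
    refine ⟨i, by omega, j, by omega, ?_⟩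
    have h3 : (z (i, j) : ℚ) ≠ 0 := by
      rw [hz']; exact mul_ne_zero hb0 hij
    simpa [Nat.le_of_lt_succ i.2, Nat.le_of_lt_succ j.2] using h3
  · have h4 := congrArg (fun p => (p.map (algebraMap K ℝ)).eval x) hh
    simp only [Polynomial.map_mul, Polynomial.map_pow, Polynomial.map_X, eval_mul, eval_pow, eval_X,
      Polynomial.map_sum, eval_finsetSum] at h4
    rw [← h4, Fintype.sum_prod_type, Finset.sum_range]
    refine Finset.sum_congr rfl fun i _ => ?_
    rw [Finset.sum_range]
    refine Finset.sum_congr rfl fun j _ => ?_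
    beta_reduce
    rw [dif_pos (And.intro i.2 j.2)]
    have h5 : (g.map (Int.castRingHom K)).map (algebraMap K ℝ) = g.map (algebraMap ℤ ℝ) := by
      rw [Polynomial.map_map]
      congr 1
    have h6 : algebraMap K ℝ a = α := IntermediateField.AdjoinSimple.algebraMap_gen ℚ α
    simp only [P, Polynomial.map_mul, Polynomial.map_pow, Polynomial.map_X, Polynomial.map_C,
      Polynomial.map_intCast, eval_mul, eval_pow, eval_X, eval_C, eval_intCast, map_pow, h5, h6,
      eval_map_algebraMap]
    ring

/-! ### Transcendence of the limit -/

namespace BlockRec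

variable {m : ℕ} {L ε g : ℕ → ℕ} {v : ℕ → ℝ}

open Polynomial in
/-- The truncations `∏ i < r, (1 + X ^ N ^ i + ⋯ + X ^ (m * N ^ i))`, `N = m + 2`. -/
noncomputable def truncation (m r : ℕ) : ℤ[X] :=
  ∏ i ∈ Finset.range r, ∑ j ∈ Finset.range (m + 1), (X ^ (m + 2) ^ i) ^ j

theorem aeval_truncation (m r : ℕ) (x : ℝ) : Polynomial.aeval x (truncation m r) =
    ∏ i ∈ Finset.range r, ∑ j ∈ Finset.range (m + 1), (x ^ (m + 2) ^ i) ^ j := by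
  simp [truncation, map_prod]

theorem one_le_aeval_truncation (m r : ℕ) {x : ℝ} (hx : 0 ≤ x) :
    1 ≤ Polynomial.aeval x (truncation m r) := by
  rw [aeval_truncation]
  induction r with
  | zero => simp
  | succ r ih =>
    rw [Finset.prod_range_succ]
    refine one_le_mul_of_one_le_of_one_le ih ?_
    rw [Finset.sum_range_succ', pow_zero]
    exact le_add_of_nonneg_left (by positivity)

theorem step_of_eq_zero (h : BlockRec m L ε g v) {k : ℕ} (hk : ε k = 0) :
    v (k + 1) = v k * ∑ j ∈ Finset.range (m + 1), scale m L k ^ j ∧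
    scale m L (k + 1) = scale m L k ^ (m + 2) := by
  rcases h.scale_eq k with ⟨-, h2, h3⟩ | ⟨h1, -⟩
  · rw [h.v_succ, h.scale_succ, h2, h3, Finset.sum_range_succ']
    refine ⟨?_, by ring⟩
    push_cast
    ring
  · omega

theorem run_eq (h : BlockRec m L ε g v) {k r : ℕ} (hk : ∀ i < r, ε (k + i) = 0) :
    v (k + r) = v k * Polynomial.aeval (scale m L k) (truncation m r) ∧
    scale m L (k + r) = scale m L k ^ (m + 2) ^ r := by
  rw [aeval_truncation]
  induction r with
  | zero => simp
  | succ r ih =>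
    obtain ⟨h1, h2⟩ := ih fun i hi => hk i (by omega)
    obtain ⟨h3, h4⟩ := h.step_of_eq_zero (hk r (by omega))
    rw [← add_assoc, h3, h4, h1, h2, Finset.prod_range_succ, ← pow_mul, ← pow_succ]
    exact ⟨by ring, rfl⟩

theorem exists_int_sum_eq (h : BlockRec m L ε g v) (D : ℕ) (q : ℕ → ℕ → ℤ) (k : ℕ) : ∃ z : ℤ,
    ∑ i ∈ Finset.range (D + 1), ∑ j ∈ Finset.range (D + 1), (q i j : ℝ) * scale m L k ^ i * v k ^ j
      = z * scale m L k ^ (2 * D) := by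
  obtain ⟨a, ha⟩ := h.exists_int_eq k
  have hX := scale_pos m L k
  set B : ℤ := (m + 1 : ℤ) ^ L k with hB
  have hBX : (B : ℝ) * scale m L k = 1 := by
    rw [hB, scale]; push_cast; rw [← mul_pow]; field_simp; simp
  have hv : v k = a * scale m L k := by
    rw [← ha, mul_assoc]
    have : ((m : ℝ) + 1) ^ L k * scale m L k = 1 := by exact_mod_cast hBX
    rw [this, mul_one]
  refine ⟨∑ i ∈ Finset.range (D + 1), ∑ j ∈ Finset.range (D + 1),
    q i j * a ^ j * B ^ (2 * D - i - j), ?_⟩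
  push_cast
  rw [Finset.sum_mul]
  refine Finset.sum_congr rfl fun i hi => ?_
  rw [Finset.sum_mul]
  refine Finset.sum_congr rfl fun j hj => ?_
  have hi' := Finset.mem_range.1 hi
  have hj' := Finset.mem_range.1 hj
  have h1 : scale m L k ^ (2 * D) =
      scale m L k ^ (2 * D - i - j) * (scale m L k ^ i * scale m L k ^ j) := by
    rw [← pow_add, ← pow_add]; congr 1; omega
  have h2 : (B : ℝ) ^ (2 * D - i - j) * scale m L k ^ (2 * D - i - j) = 1 := by
    rw [← mul_pow, hBX, one_pow]
  rw [hv, h1, mul_pow]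
  linear_combination (-(q i j : ℝ) * a ^ j * scale m L k ^ i * scale m L k ^ j) * h2

/-- The auxiliary polynomial vanishes at the points `(X k, v k)` that start a long enough run. -/
theorem eventually_sum_eq_zero (h : BlockRec m L ε g v) (hm : 1 ≤ m) {α : ℝ}
    (hα : Tendsto v atTop (nhds α)) {D r : ℕ} (hr : 2 * D + 1 ≤ (m + 2) ^ r) {q : ℕ → ℕ → ℤ}
    {p : Polynomial ℝ}
    (hq : ∀ x : ℝ, ∑ i ∈ Finset.range (D + 1), ∑ j ∈ Finset.range (D + 1),
      (q i j : ℝ) * x ^ i * α ^ j * Polynomial.aeval x (truncation m r) ^ (D - j) =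
        x ^ (2 * D + 1) * p.eval x) :
    ∀ᶠ k in atTop, (∀ i < r, ε (k + i) = 0) →
      ∑ i ∈ Finset.range (D + 1), ∑ j ∈ Finset.range (D + 1),
        (q i j : ℝ) * scale m L k ^ i * v k ^ j = 0 := by
  let H : ℝ × ℝ → ℝ := fun x => ∑ i ∈ Finset.range (D + 1), ∑ j ∈ Finset.range (D + 1),
    (q i j : ℝ) * x.1 ^ i * (∑ l ∈ Finset.range j, x.2 ^ l * α ^ (j - 1 - l)) *
      Polynomial.aeval x.1 (truncation m r) ^ (D - j)
  have hH : Continuous H := by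
    simp only [H, aeval_truncation]
    fun_prop
  obtain ⟨C, hC⟩ := (isCompact_Icc.prod isCompact_Icc).exists_bound_of_continuousOn
    (s := Set.Icc (0 : ℝ) 1 ×ˢ Set.Icc (0 : ℝ) 1) hH.continuousOn
  obtain ⟨C', hC'⟩ := isCompact_Icc.exists_bound_of_continuousOn
    (s := Set.Icc (0 : ℝ) 1) p.continuous.continuousOn
  have hlim : ∀ᶠ k in atTop, (C + C') * scale m L k < 1 := by
    have := (h.tendsto_scale hm).const_mul (C + C')
    rw [mul_zero] at this
    exact this.eventually (gt_mem_nhds one_pos)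
  have hm1 : (1 : ℝ) ≤ m := by exact_mod_cast hm
  have hα1 : α ≤ 1 := (h.limit_lt hm hα).le.trans (by rw [div_le_one (by positivity)]; exact hm1)
  filter_upwards [hlim] with k hk hrun
  obtain ⟨h1, h2⟩ := h.run_eq hrun
  set X := scale m L k with hXdef
  set γ := Polynomial.aeval X (truncation m r) with hγ
  have hX0 : 0 < X := scale_pos m L k
  have hX1 : X ≤ 1 := scale_le_one m L k
  have hγ1 : 1 ≤ γ := one_le_aeval_truncation m r hX0.le
  set w := v (k + r) with hw
  have hwα : w ≤ α := h.le_limit hα _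
  have hw0 : 0 ≤ w := h.nonneg _
  have hαw : |w - α| ≤ X ^ (2 * D + 1) := by
    rw [abs_sub_comm, abs_of_nonneg (by linarith)]
    have h3 := h.limit_le hm hα (k + r)
    have h4 : scale m L (k + r) / m ≤ scale m L (k + r) :=
      div_le_self (scale_pos m L _).le hm1
    have h5 : scale m L (k + r) ≤ X ^ (2 * D + 1) := by
      rw [h2]; exact pow_le_pow_of_le_one hX0.le hX1 hr
    linarith
  obtain ⟨z, hz⟩ := h.exists_int_sum_eq D q k
  set Q := ∑ i ∈ Finset.range (D + 1), ∑ j ∈ Finset.range (D + 1), (q i j : ℝ) * X ^ i * v k ^ j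
    with hQ
  have hid : γ ^ D * Q = X ^ (2 * D + 1) * p.eval X + (w - α) * H (X, w) := by
    rw [← hq, hQ, Finset.mul_sum, Finset.mul_sum, ← Finset.sum_add_distrib]
    refine Finset.sum_congr rfl fun i _ => ?_
    rw [Finset.mul_sum, Finset.mul_sum, ← Finset.sum_add_distrib]
    refine Finset.sum_congr rfl fun j hj => ?_
    have hj' := Finset.mem_range.1 hj
    have h3 := geom_sum₂_mul w α j
    have h4 : γ ^ D = γ ^ j * γ ^ (D - j) := by rw [← pow_add]; congr 1; omega
    have h5 : w ^ j = v k ^ j * γ ^ j := by rw [h1, mul_pow]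
    rw [h4]
    linear_combination (-(q i j : ℝ) * X ^ i * γ ^ (D - j)) * (h3 + h5)
  have hCp : |p.eval X| ≤ C' := hC' X ⟨hX0.le, hX1⟩
  have hCH : |H (X, w)| ≤ C := hC (X, w) ⟨⟨hX0.le, hX1⟩, ⟨hw0, hwα.trans hα1⟩⟩
  have hbound : |Q| ≤ (C + C') * X ^ (2 * D + 1) := by
    calc |Q| ≤ γ ^ D * |Q| := le_mul_of_one_le_left (abs_nonneg _) (one_le_pow₀ hγ1)
      _ = |γ ^ D * Q| := by rw [abs_mul, abs_of_nonneg (by positivity : 0 ≤ γ ^ D)]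
      _ ≤ |X ^ (2 * D + 1) * p.eval X| + |(w - α) * H (X, w)| := by
        rw [hid]; exact abs_add_le _ _
      _ ≤ X ^ (2 * D + 1) * C' + X ^ (2 * D + 1) * C := by
        rw [abs_mul, abs_mul, abs_of_nonneg (by positivity : 0 ≤ X ^ (2 * D + 1))]
        gcongr
      _ = _ := by ring
  rw [hz, abs_mul, abs_of_nonneg (by positivity : 0 ≤ X ^ (2 * D)), pow_succ] at hbound
  have hz1 : |(z : ℝ)| < 1 := by
    have h6 : |(z : ℝ)| * X ^ (2 * D) ≤ ((C + C') * X) * X ^ (2 * D) := by linarith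
    exact (le_of_mul_le_mul_right h6 (by positivity)).trans_lt hk
  have hz0 : z = 0 := Int.abs_lt_one_iff.1 (by exact_mod_cast hz1)
  rw [hz, hz0, Int.cast_zero, zero_mul]

end BlockRec

/-- The lowest nonvanishing coefficient of a polynomial with a small nonzero root is small. -/
theorem abs_le_of_sum_mul_pow_eq_zero {n μ : ℕ} (hμ : μ < n) {a : ℕ → ℝ} {δ : ℝ} (hδ0 : δ ≠ 0)
    (hδ1 : |δ| ≤ 1) (ha : ∀ j < μ, a j = 0) (hs : ∑ j ∈ Finset.range n, a j * δ ^ j = 0) :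
    |a μ| ≤ |δ| * ∑ j ∈ Finset.range n, |a j| := by
  have hμ' : μ ∈ Finset.range n := Finset.mem_range.2 hμ
  rw [← Finset.add_sum_erase _ _ hμ'] at hs
  have h1 : |a μ| * |δ| ^ μ ≤ (|δ| * ∑ j ∈ Finset.range n, |a j|) * |δ| ^ μ := by
    calc |a μ| * |δ| ^ μ = |∑ j ∈ (Finset.range n).erase μ, a j * δ ^ j| := by
          rw [← abs_pow, ← abs_mul, eq_neg_of_add_eq_zero_left hs, abs_neg]
      _ ≤ ∑ j ∈ (Finset.range n).erase μ, |a j * δ ^ j| := Finset.abs_sum_le_sum_abs _ _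
      _ ≤ ∑ j ∈ (Finset.range n).erase μ, |δ| ^ (μ + 1) * |a j| := by
          refine Finset.sum_le_sum fun j hj => ?_
          rcases lt_or_ge j μ with h | h
          · rw [ha j h]; simp
          · have h2 : μ + 1 ≤ j := by
              have := (Finset.mem_erase.1 hj).1
              omega
            rw [abs_mul, abs_pow, mul_comm]
            exact mul_le_mul_of_nonneg_right
              (pow_le_pow_of_le_one (abs_nonneg _) hδ1 h2) (abs_nonneg _)
      _ ≤ ∑ j ∈ Finset.range n, |δ| ^ (μ + 1) * |a j| :=
          Finset.sum_le_sum_of_subset_of_nonneg (Finset.erase_subset _ _)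
            fun _ _ _ => by positivity
      _ = _ := by rw [← Finset.mul_sum]; ring
  exact le_of_mul_le_mul_right h1 (pow_pos (abs_pos.2 hδ0) _)

/-- The `j`-th Taylor coefficient in the second variable, along `y`, of `∑ q i l x ^ i w ^ l`. -/
noncomputable def taylorCoeff (D : ℕ) (q : ℕ → ℕ → ℤ) (y : ℝ → ℝ) (j : ℕ) (x : ℝ) : ℝ :=
  ∑ i ∈ Finset.range (D + 1), ∑ l ∈ Finset.range (D + 1),
    (q i l : ℝ) * x ^ i * (l.choose j * y x ^ (l - j))

theorem sum_taylorCoeff (D : ℕ) (q : ℕ → ℕ → ℤ) (y : ℝ → ℝ) (x δ : ℝ) :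
    ∑ j ∈ Finset.range (D + 1), taylorCoeff D q y j x * δ ^ j =
      ∑ i ∈ Finset.range (D + 1), ∑ l ∈ Finset.range (D + 1),
        (q i l : ℝ) * x ^ i * (y x + δ) ^ l := by
  simp only [taylorCoeff, Finset.sum_mul]
  rw [Finset.sum_comm]
  refine Finset.sum_congr rfl fun i _ => ?_
  rw [Finset.sum_comm]
  refine Finset.sum_congr rfl fun l hl => ?_
  have hl' := Finset.mem_range.1 hl
  rw [add_comm (y x), add_pow, Finset.mul_sum]
  symm
  refine Finset.sum_subset_zero_on_sdiff (Finset.range_mono (by omega)) (fun j hj => ?_)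
    fun j _ => by ring
  have hj' : l < j := by
    simp only [Finset.mem_sdiff, Finset.mem_range] at hj
    omega
  rw [Nat.choose_eq_zero_of_lt hj']
  simp

theorem analyticAt_taylorCoeff (D : ℕ) (q : ℕ → ℕ → ℤ) {y : ℝ → ℝ} (hy : AnalyticAt ℝ y 0)
    (j : ℕ) : AnalyticAt ℝ (taylorCoeff D q y j) 0 := by
  unfold taylorCoeff
  refine Finset.analyticAt_fun_sum _ fun i _ => Finset.analyticAt_fun_sum _ fun l _ => ?_
  fun_prop

theorem exists_taylorCoeff_ne_zero {D : ℕ} {q : ℕ → ℕ → ℤ} (hq : ∃ i ≤ D, ∃ j ≤ D, q i j ≠ 0)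
    (y : ℝ → ℝ) : ∃ j ≤ D, ¬ ∀ᶠ x in nhds (0 : ℝ), taylorCoeff D q y j x = 0 := by
  let s := (Finset.range (D + 1)).filter fun l => ∃ i ≤ D, q i l ≠ 0
  have hs : s.Nonempty := by
    obtain ⟨i, hi, j, hj, h⟩ := hq
    exact ⟨j, Finset.mem_filter.2 ⟨Finset.mem_range.2 (by omega), i, hi, h⟩⟩
  obtain ⟨hl, i, hi, hil⟩ := Finset.mem_filter.1 (s.max'_mem hs)
  set l := s.max' hs with hldef
  have hl' := Finset.mem_range.1 hl
  refine ⟨l, by omega, fun h => hil ?_⟩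
  have hmax : ∀ l' < D + 1, l < l' → ∀ i ≤ D, q i l' = 0 := fun l' h1 h2 i hi => by
    by_contra h3
    exact absurd (s.le_max' l' (Finset.mem_filter.2 ⟨Finset.mem_range.2 h1, i, hi, h3⟩))
      (by omega)
  let P : Polynomial ℝ := ∑ i ∈ Finset.range (D + 1), Polynomial.monomial i (q i l : ℝ)
  have hP : ∀ x, taylorCoeff D q y l x = P.eval x := fun x => by
    simp only [taylorCoeff, P, Polynomial.eval_finsetSum, Polynomial.eval_monomial]
    refine Finset.sum_congr rfl fun i hi => ?_
    rw [Finset.sum_eq_single_of_mem l hl]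
    · simp
    · intro l' hl' hne
      rcases lt_or_gt_of_ne hne with h1 | h1
      · rw [Nat.choose_eq_zero_of_lt h1]; simp
      · rw [hmax l' (Finset.mem_range.1 hl') h1 i (Nat.le_of_lt_succ (Finset.mem_range.1 hi))]
        simp
  have hP0 : P = 0 := by
    refine Polynomial.eq_zero_of_infinite_isRoot P (infinite_of_mem_nhds 0 ?_)
    filter_upwards [h] with x hx
    exact (hP x).symm.trans hx
  have h1 : P.coeff i = q i l := by
    simp only [P, Polynomial.finsetSum_coeff, Polynomial.coeff_monomial]
    rw [Finset.sum_ite_eq', if_pos (Finset.mem_range.2 (by omega))]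
  rw [hP0, Polynomial.coeff_zero] at h1
  exact_mod_cast h1.symm

/-- Near an analytic curve `y`, the zeros of a nonzero polynomial stay polynomially far from `y`,
unless they are on it. -/
theorem exists_pow_le_of_sum_eq_zero {D : ℕ} {q : ℕ → ℕ → ℤ} (hq : ∃ i ≤ D, ∃ j ≤ D, q i j ≠ 0)
    {y : ℝ → ℝ} (hy : AnalyticAt ℝ y 0) :
    ∃ (o : ℕ) (c : ℝ), 0 < c ∧ ∀ᶠ x in nhds (0 : ℝ), ∀ δ : ℝ, δ ≠ 0 → |δ| ≤ 1 →
      ∑ i ∈ Finset.range (D + 1), ∑ l ∈ Finset.range (D + 1),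
        (q i l : ℝ) * x ^ i * (y x + δ) ^ l = 0 → c * |x| ^ o ≤ |δ| := by
  have hex := exists_taylorCoeff_ne_zero hq y
  obtain ⟨hμD, hμ⟩ := Nat.find_spec hex
  have hmin := fun j => Nat.find_min (m := j) hex
  set μ := Nat.find hex
  obtain ⟨o, c, hc, hlow⟩ := (analyticAt_taylorCoeff D q hy μ).exists_pow_le_norm hμ
  set T : ℝ → ℝ := fun x => ∑ j ∈ Finset.range (D + 1), |taylorCoeff D q y j x| with hT
  have hTc : ContinuousAt T 0 := by
    refine tendsto_finsetSum _ fun j _ => ?_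
    exact (analyticAt_taylorCoeff D q hy j).continuousAt.abs
  have hTb : ∀ᶠ x in nhds (0 : ℝ), T x < T 0 + 1 :=
    hTc.eventually (gt_mem_nhds (lt_add_one _))
  have hT0 : 0 ≤ T 0 := by positivity
  have hzero : ∀ᶠ x in nhds (0 : ℝ), ∀ j ∈ Finset.range μ, taylorCoeff D q y j x = 0 := by
    rw [eventually_all_finset]
    intro j hj
    have hj' := Finset.mem_range.1 hj
    by_contra h
    exact hmin j hj' ⟨by omega, h⟩
  refine ⟨o, c / (T 0 + 1), by positivity, ?_⟩
  filter_upwards [hlow, hTb, hzero] with x h1 h2 h3 δ hδ0 hδ1 hsum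
  rw [← sum_taylorCoeff] at hsum
  have h4 := abs_le_of_sum_mul_pow_eq_zero (Nat.lt_succ_of_le hμD) hδ0 hδ1
    (fun j hj => h3 j (Finset.mem_range.2 hj)) hsum
  have h5 : |δ| * T x ≤ |δ| * (T 0 + 1) := mul_le_mul_of_nonneg_left h2.le (abs_nonneg _)
  rw [div_mul_eq_mul_div, div_le_iff₀ (by positivity)]
  exact h1.trans (h4.trans h5)

namespace BlockRec

variable {m : ℕ} {L ε g : ℕ → ℕ} {v : ℕ → ℝ}

theorem eventually_mul_lacunary_ne (h : BlockRec m L ε g v) (hm : 1 ≤ m) {α : ℝ}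
    (hα : Tendsto v atTop (nhds α)) :
    ∀ᶠ k in atTop, ε k = 1 → v k * lacunary m (scale m L k) ≠ α := by
  have hm1 : (1 : ℝ) ≤ m := by exact_mod_cast hm
  have hα0 := h.limit_pos hm hα
  have hαm : α * m < 1 := by
    have := h.limit_lt hm hα
    rwa [lt_div_iff₀ (by positivity)] at this
  have hsc := h.tendsto_scale hm
  filter_upwards [hsc.eventually (gt_mem_nhds (half_pos hα0)),
    hα.eventually (lt_mem_nhds (half_lt_self hα0)),
    hsc.eventually (gt_mem_nhds (half_pos (sub_pos.2 hαm)))] with k h1 h2 h3 hk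
  set X := scale m L k with hX
  set x : ℝ := (1 / (m + 1)) ^ (L k + ε k) with hx
  obtain ⟨hg, hXx⟩ : g k ≤ 1 ∧ X = (m + 1) * x := by
    rcases h.scale_eq k with ⟨h4, -⟩ | ⟨-, h4⟩
    · omega
    · exact h4
  have hX0 : 0 < X := scale_pos m L k
  have hx0 : 0 < x := by positivity
  have hX1 : X < 1 := by nlinarith
  have hx1 : x ≤ 1 := by nlinarith
  have hv := h.le_limit hα k
  have hv0 := h.nonneg k
  have hvs := h.v_succ k
  rw [← hx] at hvs
  rcases Nat.le_one_iff_eq_zero_or_eq_one.1 hg with hg0 | hg1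
  · have h5 : ∑ i ∈ Finset.range m, x ^ (i + 1) ≤ m * x := by
      calc _ ≤ ∑ i ∈ Finset.range m, x := Finset.sum_le_sum fun i _ =>
            pow_le_of_le_one hx0.le hx1 (by omega)
        _ = _ := by simp
    have h6 := h.limit_le hm hα (k + 1)
    rw [h.scale_succ, hvs, hg0, Nat.cast_zero, zero_add, ← hx] at h6
    have h7 : X * x ^ (m + 1) / m ≤ X * x := by
      refine (div_le_self (by positivity) hm1).trans ?_
      exact mul_le_mul_of_nonneg_left (pow_le_of_le_one hx0.le hx1 (by omega)) hX0.le
    have h8 := le_lacunary hm hX0.le hX1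
    refine ne_of_gt ?_
    calc α ≤ v k + v k * (m * x) + X * x := by nlinarith
      _ < v k * (1 + X) := by rw [hXx] at h1 ⊢; nlinarith
      _ ≤ _ := mul_le_mul_of_nonneg_left h8 hv0
  · have h5 : x ≤ ∑ i ∈ Finset.range m, x ^ (i + 1) := by
      have := Finset.single_le_sum (f := fun i => x ^ (i + 1)) (s := Finset.range m)
        (fun i _ => by positivity) (Finset.mem_range.2 hm)
      simpa using this
    have h6 := h.le_limit hα (k + 1)
    rw [hvs, hg1, Nat.cast_one] at h6
    have h8 := lacunary_le m hX0.le hX1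
    refine ne_of_lt ?_
    calc v k * lacunary m X ≤ v k * (1 / (1 - X)) := mul_le_mul_of_nonneg_left h8 hv0
      _ < v k + (1 + v k) * x := by
        rw [mul_one_div, div_lt_iff₀ (by linarith)]
        have h9 : v k * (m + 1) < (1 + v k) * (1 - X) := by
          have hvm : v k * m ≤ α * m := by gcongr
          have hv1 : v k ≤ 1 := (le_mul_of_one_le_right hv0 hm1).trans (hvm.trans hαm.le)
          have hvX : v k * X ≤ X := mul_le_of_le_one_left hX0.le hv1
          linarith
        have h10 := mul_lt_mul_of_pos_right h9 hx0
        rw [hXx] at h10 ⊢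
        linarith
      _ ≤ v k + (1 + v k) * ∑ i ∈ Finset.range m, x ^ (i + 1) := by gcongr
      _ ≤ α := h6

theorem eventually_abs_mul_lacunary_sub_le (h : BlockRec m L ε g v) (hm : 1 ≤ m) {α : ℝ}
    (hα : Tendsto v atTop (nhds α)) :
    ∀ᶠ k in atTop, |v k * lacunary m (scale m L k) - α| ≤ 2 * scale m L k := by
  have hm1 : (1 : ℝ) ≤ m := by exact_mod_cast hm
  filter_upwards [(h.tendsto_scale hm).eventually (gt_mem_nhds (half_pos one_pos))] with k h1
  set X := scale m L k with hX
  have hX0 : 0 < X := scale_pos m L k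
  have hv := h.le_limit hα k
  have hv0 := h.nonneg k
  have hα1 : α ≤ 1 := (h.limit_lt hm hα).le.trans (by rw [div_le_one (by positivity)]; exact hm1)
  have h2 := h.limit_le hm hα k
  have h3 : X / m ≤ X := div_le_self hX0.le hm1
  have h4 := mul_le_mul_of_nonneg_left (le_lacunary hm hX0.le (by linarith)) hv0
  have h5 := mul_le_mul_of_nonneg_left (lacunary_le m hX0.le (by linarith)) hv0
  have h6 : v k * (1 / (1 - X)) ≤ v k + 2 * X := by
    rw [mul_one_div, div_le_iff₀ (by linarith)]
    nlinarith
  rw [abs_le]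
  constructor <;> nlinarith

theorem run_lacunary_eq (h : BlockRec m L ε g v) {k r : ℕ} (hk : ∀ i < r, ε (k + i) = 0)
    (hX : scale m L k < 1) :
    v (k + r) * lacunary m (scale m L (k + r)) = v k * lacunary m (scale m L k) := by
  induction r with
  | zero => rfl
  | succ r ih =>
    have hr := fun i (hi : i < r) => hk i (by omega)
    obtain ⟨h3, h4⟩ := h.step_of_eq_zero (hk r (by omega))
    have h5 : scale m L (k + r) < 1 := by
      rw [(h.run_eq hr).2]
      exact pow_lt_one₀ (scale_pos m L k).le hX (by positivity)
    rw [← ih hr, lacunary_eq m (scale_pos m L (k + r)).le h5, ← h4, ← add_assoc, h3, mul_assoc]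

theorem transcendental_limit (h : BlockRec m L ε g v) (hm : 1 ≤ m) {α : ℝ}
    (hα : Tendsto v atTop (nhds α)) : Transcendental ℚ α := by
  intro halg
  obtain ⟨D, hD⟩ := IsAlgebraic.exists_auxiliary halg
  obtain ⟨q, hq, p, hp⟩ := hD (truncation m (2 * D + 1))
  have hvan := h.eventually_sum_eq_zero hm hα (Nat.lt_pow_self (by omega)).le hp
  have hG0 : 1 ≤ lacunary m 0 := by simpa using le_lacunary hm le_rfl one_pos
  have hy : AnalyticAt ℝ (fun x => α / lacunary m x) 0 :=
    analyticAt_const.div (analyticAt_lacunary m) (by positivity)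
  obtain ⟨o, c, hc, hlow⟩ := exists_pow_le_of_sum_eq_zero hq hy
  have hsc := h.tendsto_scale hm
  set r := 2 * D + 1 + o with hr
  have hall : ∀ᶠ k in atTop, ¬ ((∀ i < r, ε (k + i) = 0) ∧ ε (k + r) = 1) := by
    filter_upwards [hvan, hsc.eventually hlow,
      (tendsto_add_atTop_nat r).eventually (h.eventually_mul_lacunary_ne hm hα),
      (tendsto_add_atTop_nat r).eventually (h.eventually_abs_mul_lacunary_sub_le hm hα),
      hsc.eventually (gt_mem_nhds (half_pos one_pos)),
      hsc.eventually (gt_mem_nhds (half_pos hc))] with k h1 h2 h3 h4 h5 h6 hrun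
    obtain ⟨hrun, hend⟩ := hrun
    set X := scale m L k with hX
    have hX0 : 0 < X := scale_pos m L k
    have hG := le_lacunary hm hX0.le (by linarith : X < 1)
    set G := lacunary m X with hGdef
    have hG1 : 1 ≤ G := by linarith
    have hrl := h.run_lacunary_eq hrun (by linarith : X < 1)
    have hδ : (v k - α / G) * G = v (k + r) * lacunary m (scale m L (k + r)) - α := by
      rw [hrl, sub_mul, div_mul_cancel₀ _ (by positivity)]
    have hδ0 : v k - α / G ≠ 0 := fun h0 => by
      rw [h0, zero_mul] at hδ
      exact h3 hend (sub_eq_zero.1 hδ.symm)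
    have hpow : scale m L (k + r) ≤ X ^ (o + 1) := by
      rw [(h.run_eq hrun).2]
      refine pow_le_pow_of_le_one hX0.le (by linarith) ?_
      calc o + 1 ≤ r := by omega
        _ ≤ (m + 2) ^ r := (Nat.lt_pow_self (by omega)).le
    have hδ1 : |v k - α / G| ≤ 2 * X ^ (o + 1) := by
      calc _ ≤ |v k - α / G| * G := le_mul_of_one_le_right (abs_nonneg _) hG1
        _ = |(v k - α / G) * G| := by rw [abs_mul, abs_of_pos (by positivity : 0 < G)]
        _ ≤ 2 * scale m L (k + r) := by rw [hδ]; exact h4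
        _ ≤ _ := by linarith
    have hX2 : X ^ (o + 1) ≤ X := pow_le_of_le_one hX0.le (by linarith) (by omega)
    have h7 := h2 (v k - α / G) hδ0 (by linarith) (by
      simp only [add_sub_cancel]
      exact h1 fun i hi => hrun i (by omega))
    rw [abs_of_pos hX0] at h7
    have h8 : c * X ^ o ≤ (2 * X) * X ^ o := by
      calc _ ≤ _ := h7.trans hδ1
        _ = _ := by ring
    linarith [le_of_mul_le_mul_right h8 (by positivity)]
  obtain ⟨K, hK⟩ := eventually_atTop.1 hall
  obtain ⟨k, hk, hrun⟩ := h.exists_run r K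
  exact hK k hk hrun

end BlockRec

/-- Theorem `num transcendental`. For `m ≥ 2`, `ν_m` is transcendental
over `ℚ` and there are infinitely many `(p,q)`, `q > 0`, with
`0 < |ν_m − p/q| < 1/q^{m+1}`; in particular `μ(ν_m) ≥ m+1`. -/
theorem statement12 (hSH : StandingHyp) (m : ℕ) (hm : 2 ≤ m) (ν : ℝ)
    (hν : Tendsto (fun x : ℕ => (x : ℝ) / (iota m x : ℝ)) atTop (nhds ν)) :
    Transcendental ℚ ν ∧
    {pq : ℤ × ℤ | 0 < pq.2 ∧ 0 < |ν - (pq.1 : ℝ) / (pq.2 : ℝ)| ∧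
      |ν - (pq.1 : ℝ) / (pq.2 : ℝ)| < 1 / (pq.2 : ℝ) ^ (m + 1)}.Infinite := by
  obtain ⟨L, ε, g, v, h, α, hα, hνα⟩ := exists_blockRec hSH hm hν
  have htr : Transcendental ℚ ν := by
    intro halg
    refine h.transcendental_limit (by omega) hα ?_
    have h1 : α = algebraMap ℚ ℝ ((m + 1) / m) * ν - algebraMap ℚ ℝ 1 := by
      have hm0 : (m : ℝ) ≠ 0 := by positivity
      rw [hνα]
      simp only [map_div₀, map_add, map_natCast, map_one]
      field_simp
      ring
    rw [h1]
    exact ((isAlgebraic_algebraMap _).mul halg).sub (isAlgebraic_algebraMap _)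
  exact ⟨htr, h.infinite_approximations (by omega) hα hνα htr⟩
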